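/- arXiv:2204.10837 — 4 statements merged into one kernel-verified Lean document; each statement's English description precedes it below -/
import Mathlib

section
/- The family consisting of 1 together with all monomials v(0)^k v(1)^p v(m), where k, p ≥ 0, m ≥ 0, and m ≥ 1 whenever p > 0, is a ℚ-vector-space basis of Λ. (Equivalently, the words reduced with respect to the Gröbner–Shirshov basis of A₊(U(3)) form a linear basis.) -/
/-- The generator `v(n)` in the free associative ℚ-algebra on countably many
generators. -/
noncomputable def vf (n : ℕ) : FreeAlgebra ℚ ℕ := FreeAlgebra.ι ℚ n

/-- The defining relations of `Λ` (the unitalization of `A₊(U(3))`):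
* locality: for `n ≥ 3` (written `n = k + 3`) and `m ≥ 0`,
  `v(n)v(m) - 3v(n-1)v(m+1) + 3v(n-2)v(m+2) - v(n-3)v(m+3) = 0`;
* commutator: for `n > m ≥ 0` (written `n = m + k + 1`),
  `v(n)v(m) - v(m)v(n) = (n - m)·v(n+m-1)`. -/
inductive LambdaRel : FreeAlgebra ℚ ℕ → FreeAlgebra ℚ ℕ → Prop
  | locality (k m : ℕ) :
      LambdaRel (vf (k + 3) * vf m + 3 * (vf (k + 1) * vf (m + 2)))
        (3 * (vf (k + 2) * vf (m + 1)) + vf k * vf (m + 3))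
  | commutator (m k : ℕ) :
      LambdaRel (vf (m + k + 1) * vf m)
        (vf m * vf (m + k + 1) + ((k : ℚ) + 1) • vf (2 * m + k))

/-- The unital associative ℚ-algebra `Λ` presented by the generators `v(n)`,
`n ∈ ℕ`, and the relations `LambdaRel`. -/
abbrev Lambda : Type := RingQuot LambdaRel

/-- The generator `v(n)` of `Λ`. -/
noncomputable def v (n : ℕ) : Lambda := RingQuot.mkAlgHom ℚ LambdaRel (vf n)

section

open Polynomial

/-! ### The reduced words span -/

/-- The reduced words `v(0)^k v(1)^p v(m)` together with `1`. -/
noncomputable def reducedWord :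
    {t : ℕ × ℕ × ℕ // 0 < t.2.1 → 1 ≤ t.2.2} ⊕ Unit → Lambda
  | Sum.inl t => v 0 ^ t.1.1 * v 1 ^ t.1.2.1 * v t.1.2.2
  | Sum.inr _ => 1

theorem v_locality (k m : ℕ) :
    v (k + 3) * v m + 3 * (v (k + 1) * v (m + 2)) =
      3 * (v (k + 2) * v (m + 1)) + v k * v (m + 3) := by
  have h3 : RingQuot.mkAlgHom ℚ LambdaRel 3 = 3 := map_ofNat _ 3
  simpa only [v, map_mul, map_add, h3] using
    RingQuot.mkAlgHom_rel ℚ (LambdaRel.locality k m)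

theorem v_commutator (m k : ℕ) :
    v (m + k + 1) * v m = v m * v (m + k + 1) + ((k : ℚ) + 1) • v (2 * m + k) := by
  simpa only [v, map_mul, map_add, map_smul] using
    RingQuot.mkAlgHom_rel ℚ (LambdaRel.commutator m k)

/-- A sequence with vanishing third differences is quadratic. -/
theorem eq_quadratic_of_third_difference {M : Type*} [AddCommGroup M] [Module ℚ M]
    (f : ℕ → M) (N : ℕ)
    (hf : ∀ k, k + 3 ≤ N →
      f (k + 3) + (3 : ℚ) • f (k + 1) = (3 : ℚ) • f (k + 2) + f k)
    (i : ℕ) (hi : i ≤ N) :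
    f i = f 0 + (i : ℚ) • (f 1 - f 0) +
      ((i : ℚ) * (i - 1) / 2) • (f 2 - (2 : ℚ) • f 1 + f 0) := by
  induction i using Nat.strong_induction_on with
  | _ i ih =>
    match i, hi, ih with
    | 0, _, _ => simp
    | 1, _, _ => simp
    | 2, _, _ => norm_num; module
    | k + 3, hi, ih =>
      have h0 := ih k (by omega) (by omega)
      have h1 := ih (k + 1) (by omega) (by omega)
      have h2 := ih (k + 2) (by omega) (by omega)
      have h3 := hf k hi
      rw [h0, h1, h2] at h3
      rw [eq_sub_of_add_eq h3]
      push_cast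
      module

theorem v_one_mul_v_zero_pow (k : ℕ) :
    v 1 * v 0 ^ k = v 0 ^ k * v 1 + (k : ℚ) • v 0 ^ k := by
  have h : v 1 * v 0 = v 0 * v 1 + v 0 := by simpa using v_commutator 0 0
  induction k with
  | zero => simp
  | succ k ih =>
    rw [pow_succ, ← mul_assoc, ih, add_mul, mul_assoc, h, mul_add, smul_mul_assoc, mul_assoc]
    push_cast
    module

/-- The span of the reduced words. -/
noncomputable def reducedSpan : Submodule ℚ Lambda :=
  Submodule.span ℚ (Set.range reducedWord)

theorem one_mem_reducedSpan : (1 : Lambda) ∈ reducedSpan :=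
  Submodule.subset_span ⟨Sum.inr (), rfl⟩

theorem word_mem_reducedSpan (k p m : ℕ) (h : 0 < p → 1 ≤ m) :
    v 0 ^ k * v 1 ^ p * v m ∈ reducedSpan :=
  Submodule.subset_span ⟨Sum.inl ⟨(k, p, m), h⟩, rfl⟩

theorem v_mem_reducedSpan (m : ℕ) : v m ∈ reducedSpan := by
  simpa using word_mem_reducedSpan 0 0 m (by simp)

theorem mul_mem_reducedSpan_of_left {a : Lambda}
    (h : ∀ t, a * reducedWord t ∈ reducedSpan) {x : Lambda} (hx : x ∈ reducedSpan) :
    a * x ∈ reducedSpan := by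
  have : reducedSpan ≤ reducedSpan.comap (LinearMap.mulLeft ℚ a) := by
    refine Submodule.span_le.2 ?_
    rintro _ ⟨t, rfl⟩
    exact h t
  exact this hx

theorem mul_mem_reducedSpan_of_right {a : Lambda}
    (h : ∀ t, reducedWord t * a ∈ reducedSpan) {x : Lambda} (hx : x ∈ reducedSpan) :
    x * a ∈ reducedSpan := by
  have : reducedSpan ≤ reducedSpan.comap (LinearMap.mulRight ℚ a) := by
    refine Submodule.span_le.2 ?_
    rintro _ ⟨t, rfl⟩
    exact h t
  exact this hx

theorem v_zero_mul_mem {x : Lambda} (hx : x ∈ reducedSpan) : v 0 * x ∈ reducedSpan := by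
  refine mul_mem_reducedSpan_of_left ?_ hx
  rintro (⟨⟨k, p, m⟩, h⟩ | _)
  · simpa only [reducedWord, pow_succ', mul_assoc] using word_mem_reducedSpan (k + 1) p m h
  · simpa [reducedWord] using v_mem_reducedSpan 0

theorem v_one_mul_mem {x : Lambda} (hx : x ∈ reducedSpan) : v 1 * x ∈ reducedSpan := by
  refine mul_mem_reducedSpan_of_left ?_ hx
  rintro (⟨⟨k, p, m⟩, h⟩ | _)
  · simp only [reducedWord]
    rcases Nat.eq_zero_or_pos m with rfl | hm
    · obtain rfl : p = 0 := by simpa using h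
      have h1 := word_mem_reducedSpan (k + 1) 0 1 (by simp)
      have h2 := word_mem_reducedSpan k 0 0 (by simp)
      rw [pow_zero, mul_one] at h1 h2 ⊢
      rw [← pow_succ] at h2 ⊢
      rw [v_one_mul_v_zero_pow]
      exact add_mem h1 (Submodule.smul_mem _ _ h2)
    · have e : v 1 * (v 0 ^ k * v 1 ^ p * v m) =
          v 0 ^ k * v 1 ^ (p + 1) * v m + (k : ℚ) • (v 0 ^ k * v 1 ^ p * v m) := by
        rw [← mul_assoc, ← mul_assoc, v_one_mul_v_zero_pow, pow_succ']
        simp only [add_mul, smul_mul_assoc, mul_assoc]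
      rw [e]
      exact add_mem (word_mem_reducedSpan _ _ _ fun _ => hm)
        (Submodule.smul_mem _ _ (word_mem_reducedSpan _ _ _ h))
  · simpa [reducedWord] using v_mem_reducedSpan 1

theorem v_mul_v_mem (i j : ℕ) : v i * v j ∈ reducedSpan := by
  match i with
  | 0 => exact v_zero_mul_mem (v_mem_reducedSpan j)
  | 1 => exact v_one_mul_mem (v_mem_reducedSpan j)
  | i + 2 =>
    set N := i + 2 + j with hN
    set f : ℕ → Lambda := fun l => v l * v (N - l) with hf
    have hquad := eq_quadratic_of_third_difference f N (fun k hk => by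
      obtain ⟨m, hm⟩ := Nat.exists_eq_add_of_le hk
      have e := v_locality k m
      simp only [hf, hm, show k + 3 + m - (k + 3) = m by omega,
        show k + 3 + m - (k + 1) = m + 2 by omega,
        show k + 3 + m - (k + 2) = m + 1 by omega, show k + 3 + m - k = m + 3 by omega]
      have h3 (x : Lambda) : (3 : ℚ) • x = 3 * x := by
        rw [Algebra.smul_def, map_ofNat]
      rwa [h3, h3])
    have hf0 : f 0 ∈ reducedSpan := v_zero_mul_mem (v_mem_reducedSpan _)
    have hf1 : f 1 ∈ reducedSpan := v_one_mul_mem (v_mem_reducedSpan _)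
    have ha := sub_mem hf1 hf0
    have hfN : f N ∈ reducedSpan := by
      have e := v_commutator 0 (i + 1 + j)
      have : f N = v (0 + (i + 1 + j) + 1) * v 0 := by
        simp only [hf, Nat.sub_self]
        congr 2
        omega
      rw [this, e]
      exact add_mem (v_zero_mul_mem (v_mem_reducedSpan _))
        (Submodule.smul_mem _ _ (v_mem_reducedSpan _))
    have hb : f 2 - (2 : ℚ) • f 1 + f 0 ∈ reducedSpan := by
      rw [hquad N le_rfl] at hfN
      have h := (Submodule.add_mem_iff_right _
        (add_mem hf0 (Submodule.smul_mem _ (N : ℚ) ha))).1 hfN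
      refine (Submodule.smul_mem_iff _ ?_).1 h
      have h2 : (N : ℚ) = i + j + 2 := by rw [hN]; push_cast; ring
      have : (0 : ℚ) < (N : ℚ) * (N - 1) / 2 := by
        rw [h2, show (i : ℚ) + j + 2 - 1 = i + j + 1 by ring]
        positivity
      exact this.ne'
    have : v (i + 2) * v j = f (i + 2) := by simp [hf, hN]
    rw [this, hquad (i + 2) (by omega)]
    exact add_mem (add_mem hf0 (Submodule.smul_mem _ _ ha)) (Submodule.smul_mem _ _ hb)

theorem mul_v_mem {x : Lambda} (hx : x ∈ reducedSpan) (n : ℕ) : x * v n ∈ reducedSpan := by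
  refine mul_mem_reducedSpan_of_right ?_ hx
  rintro (⟨⟨k, p, m⟩, h⟩ | _)
  · simp only [reducedWord, mul_assoc]
    have h1 : v 1 ^ p * (v m * v n) ∈ reducedSpan := by
      induction p with
      | zero => simpa using v_mul_v_mem m n
      | succ p ih =>
        rw [pow_succ', mul_assoc]
        exact v_one_mul_mem (ih fun _ => h (Nat.succ_pos p))
    clear h
    induction k with
    | zero => simpa using h1
    | succ k ih =>
      rw [pow_succ', mul_assoc]
      exact v_zero_mul_mem ih
  · simpa [reducedWord] using v_mem_reducedSpan n

theorem reducedSpan_eq_top : reducedSpan = ⊤ := by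
  have key (x : FreeAlgebra ℚ ℕ) :
      ∀ y ∈ reducedSpan, y * RingQuot.mkAlgHom ℚ LambdaRel x ∈ reducedSpan := by
    induction x using FreeAlgebra.induction with
    | grade0 r =>
      intro y hy
      rw [AlgHom.commutes, ← Algebra.commutes, ← Algebra.smul_def]
      exact Submodule.smul_mem _ _ hy
    | grade1 n => exact fun y hy => mul_v_mem hy n
    | mul a b ha hb =>
      intro y hy
      rw [map_mul, ← mul_assoc]
      exact hb _ (ha y hy)
    | add a b ha hb =>
      intro y hy
      rw [map_add, mul_add]
      exact add_mem (ha y hy) (hb y hy)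
  refine eq_top_iff.2 fun x _ => ?_
  obtain ⟨a, rfl⟩ := RingQuot.mkAlgHom_surjective ℚ LambdaRel x
  simpa using key a 1 one_mem_reducedSpan

/-! ### A representation by difference operators -/

/-- The operator by which `v(n)` acts on a family of tensor density modules: it sends the basis
vector of index `i` to `s - i + n d` times the basis vector of index `i + n - 1`. -/
def densityOp {R : Type*} [CommRing R] [Algebra ℚ R] (s d : R) (n : ℕ) :
    Module.End ℚ (ℤ → R) where
  toFun g i := (s - ((i - n + 1 : ℤ) : R) + n * d) * g (i - n + 1)
  map_add' g h := by
    funext i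
    simp [mul_add]
  map_smul' c g := by
    funext i
    simp

theorem densityOp_single {R : Type*} [CommRing R] [Algebra ℚ R] (s d : R) (n : ℕ) (i : ℤ)
    (r : R) :
    densityOp s d n (Pi.single i r) = Pi.single (i + n - 1) ((s - (i : R) + n * d) * r) := by
  funext j
  simp only [densityOp, LinearMap.coe_mk, AddHom.coe_mk]
  by_cases h : j = i + n - 1
  · rw [h, show i + n - 1 - n + 1 = i by ring, Pi.single_eq_same, Pi.single_eq_same]
  · rw [Pi.single_eq_of_ne h, Pi.single_eq_of_ne (by omega), mul_zero]

/-- The representation of `Λ` on a family of tensor density modules. -/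
noncomputable def densityRep {R : Type*} [CommRing R] [Algebra ℚ R] (s d : R) :
    Lambda →ₐ[ℚ] Module.End ℚ (ℤ → R) :=
  RingQuot.liftAlgHom ℚ ⟨FreeAlgebra.lift ℚ (densityOp s d), by
    have h3 : (3 : Module.End ℚ (ℤ → R)) = algebraMap ℚ _ 3 := (map_ofNat _ 3).symm
    rintro _ _ (⟨k, m⟩ | ⟨m, k⟩)
    · simp only [vf, map_add, map_mul, map_ofNat, FreeAlgebra.lift_ι_apply]
      refine LinearMap.ext fun g => funext fun i => ?_
      simp only [h3, LinearMap.add_apply, Module.End.mul_apply, Module.algebraMap_end_apply,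
        Pi.add_apply, Pi.smul_apply, densityOp, LinearMap.coe_mk, AddHom.coe_mk]
      rw [Algebra.smul_def, Algebra.smul_def, map_ofNat]
      rw [show i - ((k + 3 : ℕ) : ℤ) + 1 - (m : ℕ) + 1 = i - k - m - 1 by push_cast; ring,
        show i - ((k + 1 : ℕ) : ℤ) + 1 - (m + 2 : ℕ) + 1 = i - k - m - 1 by push_cast; ring,
        show i - ((k + 2 : ℕ) : ℤ) + 1 - (m + 1 : ℕ) + 1 = i - k - m - 1 by push_cast; ring,
        show i - (k : ℤ) + 1 - (m + 3 : ℕ) + 1 = i - k - m - 1 by push_cast; ring]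
      push_cast
      ring
    · simp only [vf, map_add, map_mul, map_smul, FreeAlgebra.lift_ι_apply]
      refine LinearMap.ext fun g => funext fun i => ?_
      simp only [LinearMap.add_apply, Module.End.mul_apply, LinearMap.smul_apply,
        Pi.add_apply, Pi.smul_apply, densityOp, LinearMap.coe_mk, AddHom.coe_mk]
      rw [Algebra.smul_def, map_add, map_natCast, map_one]
      rw [show i - ((m + k + 1 : ℕ) : ℤ) + 1 - (m : ℕ) + 1 = i - (2 * m + k : ℕ) + 1 by
          push_cast; ring,
        show i - (m : ℤ) + 1 - (m + k + 1 : ℕ) + 1 = i - (2 * m + k : ℕ) + 1 by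
          push_cast; ring]
      push_cast
      ring⟩

theorem densityRep_v {R : Type*} [CommRing R] [Algebra ℚ R] (s d : R) (n : ℕ) :
    densityRep s d (v n) = densityOp s d n := by
  simp [densityRep, v, vf]

theorem densityOp_one_pow_single {R : Type*} [CommRing R] [Algebra ℚ R] (s d : R) (p : ℕ)
    (i : ℤ) (r : R) :
    (densityOp s d 1 ^ p) (Pi.single i r) = Pi.single i ((s - (i : R) + d) ^ p * r) := by
  induction p with
  | zero => simp
  | succ p ih =>
    rw [pow_succ', Module.End.mul_apply, ih, densityOp_single]
    simp [pow_succ', mul_assoc]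

theorem densityOp_zero_pow_single {R : Type*} [CommRing R] [Algebra ℚ R] (s d : R) (k : ℕ)
    (i : ℤ) (r : R) :
    (densityOp s d 0 ^ k) (Pi.single i r) =
      Pi.single (i - k) ((∏ j ∈ Finset.range k, (s - ((i - j : ℤ) : R))) * r) := by
  induction k with
  | zero => simp
  | succ k ih =>
    rw [pow_succ', Module.End.mul_apply, ih, densityOp_single, Finset.prod_range_succ]
    congr 1
    · push_cast; ring
    · push_cast; ring

theorem densityRep_word_single {R : Type*} [CommRing R] [Algebra ℚ R] (s d : R) (k p m : ℕ) :
    densityRep s d (v 0 ^ k * v 1 ^ p * v m) (Pi.single 0 1) =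
      Pi.single ((m : ℤ) - 1 - k)
        ((∏ j ∈ Finset.range k, (s - (((m : ℤ) - 1 - j : ℤ) : R))) *
          ((s - ((m - 1 : ℤ) : R) + d) ^ p * (s + m * d))) := by
  rw [map_mul, map_mul, map_pow, map_pow, densityRep_v, densityRep_v, densityRep_v,
    Module.End.mul_apply, Module.End.mul_apply, densityOp_single, densityOp_one_pow_single,
    densityOp_zero_pow_single]
  simp

/-! ### Linear independence -/

/-- A family that is triangular with respect to a family of functionals is linearly
independent. -/
theorem linearIndependent_of_triangular {K M ι α : Type*} [Field K] [AddCommGroup M]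
    [Module K M] [LinearOrder α] (f : ι → M) (φ : ι → M →ₗ[K] K) (r : ι → α)
    (hdiag : ∀ i, φ i (f i) ≠ 0) (htri : ∀ i j, j ≠ i → r j ≤ r i → φ i (f j) = 0) :
    LinearIndependent K f := by
  rw [linearIndependent_iff]
  intro l hl
  by_contra hne
  obtain ⟨i, hi, hmax⟩ := l.support.exists_max_image r (Finsupp.support_nonempty_iff.2 hne)
  have h := congrArg (φ i) hl
  rw [Finsupp.linearCombination_apply, Finsupp.sum, map_sum, map_zero,
    Finset.sum_eq_single_of_mem i hi fun j hj hji => by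
      rw [map_smul, htri i j hji (hmax j hj), smul_zero], map_smul, smul_eq_mul] at h
  exact (mul_ne_zero (Finsupp.mem_support_iff.1 hi) (hdiag i)) h

/-- The image of the basis vector of index `0` under a word `v(0)^k v(1)^p v(m)`, with the
density `d` and the offset `s` as polynomial variables. -/
noncomputable def wordPoly (k p m : ℕ) : ℚ[X][X] :=
  C (∏ j ∈ Finset.range k, (X - C ((m : ℚ) - 1 - j))) *
    ((X + C (X - C ((m : ℚ) - 1))) ^ p * (C (C (m : ℚ)) * X + C X))

/-- The vector obtained by applying an element of `Λ` to the basis vector of index `0`. -/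
noncomputable def densityVector : Lambda →ₗ[ℚ] ℤ → ℚ[X][X] :=
  (LinearMap.applyₗ (Pi.single 0 1)).comp (densityRep (C X : ℚ[X][X]) X).toLinearMap

theorem densityVector_apply (x : Lambda) :
    densityVector x = densityRep (C X : ℚ[X][X]) X x (Pi.single 0 1) := rfl

theorem wordPoly_eq (k p m : ℕ) :
    (∏ j ∈ Finset.range k, ((C X : ℚ[X][X]) - (((m : ℤ) - 1 - j : ℤ) : ℚ[X][X]))) *
      ((C X - ((m - 1 : ℤ) : ℚ[X][X]) + X) ^ p * (C X + (m : ℚ[X][X]) * X)) =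
        wordPoly k p m := by
  have h : (C X : ℚ[X][X]) - ((m - 1 : ℤ) : ℚ[X][X]) + X = X + C (X - C ((m : ℚ) - 1)) := by
    simp only [map_sub, map_natCast, map_one, Int.cast_sub, Int.cast_natCast, Int.cast_one]
    ring
  rw [wordPoly, h, add_comm (C X) (_ * X)]
  simp only [map_prod, map_sub, map_natCast, map_one, Int.cast_sub, Int.cast_natCast,
    Int.cast_one]

theorem densityVector_word (k p m : ℕ) :
    densityVector (v 0 ^ k * v 1 ^ p * v m) = Pi.single ((m : ℤ) - 1 - k) (wordPoly k p m) := by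
  rw [densityVector_apply, densityRep_word_single, wordPoly_eq]

theorem densityVector_one : densityVector 1 = Pi.single 0 1 := by
  simp [densityVector]

theorem prod_X_sub_natDegree (k : ℕ) (a : ℕ → ℚ) :
    (∏ j ∈ Finset.range k, (X - C (a j))).natDegree = k := by
  simp [natDegree_prod_of_monic _ _ fun j _ => monic_X_sub_C (a j)]

theorem prod_X_sub_coeff (k : ℕ) (a : ℕ → ℚ) :
    (∏ j ∈ Finset.range k, (X - C (a j))).coeff k = 1 := by
  have h := (monic_prod_of_monic (Finset.range k) _ fun j _ => monic_X_sub_C (a j)).coeff_natDegree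
  rwa [prod_X_sub_natDegree] at h

theorem wordPoly_natDegree_le (k p m : ℕ) : (wordPoly k p m).natDegree ≤ p + 1 := by
  unfold wordPoly
  compute_degree

theorem wordPoly_coeff_succ (k p m : ℕ) :
    (wordPoly k p m).coeff (p + 1) =
      (∏ j ∈ Finset.range k, (X - C ((m : ℚ) - 1 - j))) * C (m : ℚ) := by
  have h1 : ((X + C (X - C ((m : ℚ) - 1))) ^ p : ℚ[X][X]).coeff p = 1 := by
    have h := ((monic_X_add_C (X - C ((m : ℚ) - 1))).pow p).coeff_natDegree
    rwa [natDegree_pow, natDegree_X_add_C, mul_one] at h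
  have h2 : ((X + C (X - C ((m : ℚ) - 1))) ^ p : ℚ[X][X]).natDegree ≤ p := by compute_degree
  rw [wordPoly, coeff_C_mul, coeff_mul_add_eq_of_natDegree_le h2 natDegree_linear_le, h1]
  simp

theorem wordPoly_zero_zero (k : ℕ) :
    wordPoly k 0 0 = C ((∏ j ∈ Finset.range k, (X - C ((0 : ℚ) - 1 - j))) * X) := by
  simp [wordPoly]

/-- The index of the only nonzero entry of `densityVector (reducedWord t)`. -/
def entryIndex : {t : ℕ × ℕ × ℕ // 0 < t.2.1 → 1 ≤ t.2.2} ⊕ Unit → ℤ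
  | Sum.inl t => (t.1.2.2 : ℤ) - 1 - t.1.1
  | Sum.inr _ => 0

/-- The only nonzero entry of `densityVector (reducedWord t)`. -/
noncomputable def entry : {t : ℕ × ℕ × ℕ // 0 < t.2.1 → 1 ≤ t.2.2} ⊕ Unit → ℚ[X][X]
  | Sum.inl t => wordPoly t.1.1 t.1.2.1 t.1.2.2
  | Sum.inr _ => 1

/-- The degree of `entry t` in the density variable. -/
def densityDegree : {t : ℕ × ℕ × ℕ // 0 < t.2.1 → 1 ≤ t.2.2} ⊕ Unit → ℕ
  | Sum.inl t => if t.1.2.2 = 0 then 0 else t.1.2.1 + 1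
  | Sum.inr _ => 0

/-- The degree in the offset variable of the leading coefficient of `entry t`. -/
def offsetDegree : {t : ℕ × ℕ × ℕ // 0 < t.2.1 → 1 ≤ t.2.2} ⊕ Unit → ℕ
  | Sum.inl t => if t.1.2.2 = 0 then t.1.1 + 1 else t.1.1
  | Sum.inr _ => 0

theorem densityVector_reducedWord (t : {t : ℕ × ℕ × ℕ // 0 < t.2.1 → 1 ≤ t.2.2} ⊕ Unit) :
    densityVector (reducedWord t) = Pi.single (entryIndex t) (entry t) := by
  rcases t with t | _
  · exact densityVector_word _ _ _
  · exact densityVector_one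

theorem entry_natDegree_le (t : {t : ℕ × ℕ × ℕ // 0 < t.2.1 → 1 ≤ t.2.2} ⊕ Unit) :
    (entry t).natDegree ≤ densityDegree t := by
  rcases t with ⟨⟨k, p, m⟩, h⟩ | _
  · rcases Nat.eq_zero_or_pos m with rfl | hm
    · obtain rfl : p = 0 := by simpa using h
      simp only [entry, wordPoly_zero_zero, natDegree_C, zero_le]
    · simpa only [entry, densityDegree, hm.ne', if_false] using wordPoly_natDegree_le k p m
  · simp [entry]

theorem entry_coeff_natDegree_le (t : {t : ℕ × ℕ × ℕ // 0 < t.2.1 → 1 ≤ t.2.2} ⊕ Unit) :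
    ((entry t).coeff (densityDegree t)).natDegree ≤ offsetDegree t := by
  rcases t with ⟨⟨k, p, m⟩, h⟩ | _
  · rcases Nat.eq_zero_or_pos m with rfl | hm
    · obtain rfl : p = 0 := by simpa using h
      simp only [entry, densityDegree, offsetDegree, if_true, wordPoly_zero_zero, coeff_C_zero]
      refine natDegree_mul_le.trans ?_
      rw [prod_X_sub_natDegree, natDegree_X]
    · simp only [entry, densityDegree, offsetDegree, hm.ne', if_false, wordPoly_coeff_succ]
      refine (natDegree_mul_C_le _ _).trans ?_
      rw [prod_X_sub_natDegree]
  · simp [entry, densityDegree]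

theorem entry_coeff_coeff_ne_zero (t : {t : ℕ × ℕ × ℕ // 0 < t.2.1 → 1 ≤ t.2.2} ⊕ Unit) :
    ((entry t).coeff (densityDegree t)).coeff (offsetDegree t) ≠ 0 := by
  rcases t with ⟨⟨k, p, m⟩, h⟩ | _
  · rcases Nat.eq_zero_or_pos m with rfl | hm
    · obtain rfl : p = 0 := by simpa using h
      simp only [entry, densityDegree, offsetDegree, if_true, wordPoly_zero_zero, coeff_C_zero]
      rw [coeff_mul_X, prod_X_sub_coeff]
      exact one_ne_zero
    · simp only [entry, densityDegree, offsetDegree, hm.ne', if_false, wordPoly_coeff_succ]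
      rw [coeff_mul_C, prod_X_sub_coeff, one_mul]
      exact_mod_cast hm.ne'
  · simp [entry, densityDegree, offsetDegree]

theorem eq_of_degrees_eq {t u : {t : ℕ × ℕ × ℕ // 0 < t.2.1 → 1 ≤ t.2.2} ⊕ Unit}
    (h₁ : densityDegree t = densityDegree u) (h₂ : offsetDegree t = offsetDegree u)
    (h₃ : entryIndex t = entryIndex u) : t = u := by
  rcases t with ⟨⟨k, p, m⟩, h⟩ | _ <;> rcases u with ⟨⟨k', p', m'⟩, h'⟩ | _
  · change 0 < p → 1 ≤ m at h
    change 0 < p' → 1 ≤ m' at h'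
    simp only [densityDegree, offsetDegree, entryIndex, Sum.inl.injEq, Subtype.mk.injEq,
      Prod.mk.injEq] at h₁ h₂ h₃ ⊢
    split_ifs at h₁ h₂ <;> omega
  · simp only [densityDegree, offsetDegree] at h₁ h₂
    split_ifs at h₁ h₂
  · simp only [densityDegree, offsetDegree] at h₁ h₂
    split_ifs at h₁ h₂
  · rfl

theorem linearIndependent_reducedWord : LinearIndependent ℚ reducedWord := by
  refine LinearIndependent.of_comp densityVector ?_
  refine linearIndependent_of_triangular _
    (fun t => (lcoeff ℚ (offsetDegree t)).comp
      (((lcoeff ℚ[X] (densityDegree t)).restrictScalars ℚ).comp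
        (LinearMap.proj (entryIndex t))))
    (fun t => toLex (densityDegree t, offsetDegree t)) ?_ ?_
  · intro t
    simpa [densityVector_reducedWord] using entry_coeff_coeff_ne_zero t
  · intro t u hne hle
    simp only [Function.comp_apply, densityVector_reducedWord, LinearMap.comp_apply,
      LinearMap.proj_apply, LinearMap.restrictScalars_apply, lcoeff_apply]
    by_cases hw : entryIndex t = entryIndex u
    · rw [hw, Pi.single_eq_same]
      rcases Prod.Lex.toLex_le_toLex.1 hle with hlt | ⟨heq, hle⟩
      · rw [coeff_eq_zero_of_natDegree_lt ((entry_natDegree_le u).trans_lt hlt), coeff_zero]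
      · dsimp only at heq hle
        rw [← heq]
        refine coeff_eq_zero_of_natDegree_lt ((entry_coeff_natDegree_le u).trans_lt ?_)
        exact lt_of_le_of_ne hle fun h => hne (eq_of_degrees_eq heq h hw.symm)
    · rw [Pi.single_eq_of_ne hw, coeff_zero, coeff_zero]

end

/-- the family consisting of `1` together with all monomials
`v(0)^k v(1)^p v(m)`, where `k, p, m ≥ 0` and `m ≥ 1` whenever `p > 0`, is a
ℚ-vector-space basis of `Λ`. -/
theorem reduced_words_basis :
    ∃ B : Module.Basis ({t : ℕ × ℕ × ℕ // 0 < t.2.1 → 1 ≤ t.2.2} ⊕ Unit) ℚ Lambda,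
      (∀ t, B (Sum.inl t) = v 0 ^ t.1.1 * v 1 ^ t.1.2.1 * v t.1.2.2) ∧
      B (Sum.inr ()) = 1 := by
  have hspan : ⊤ ≤ Submodule.span ℚ (Set.range reducedWord) := reducedSpan_eq_top.ge
  exact ⟨Module.Basis.mk linearIndependent_reducedWord hspan,
    fun _ => Module.Basis.mk_apply _ _ _, Module.Basis.mk_apply _ _ _⟩
end

section
/- For n ≥ 2, every a ∈ K_n satisfies (a_0)_0 = 0 and (∂̃_{n−1}(a_0))_1 = 0; moreover the ℚ-linear map K_n → A_{n−1} sending a to a_0 is injective (every element of K_n is completely determined by its component a_0). -/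
open Finset

/-- A list `[m_1, …, m_n]` of natural numbers is an Anick chain if it is nonempty,
`m_j ≥ 2` for all `1 ≤ j ≤ n-2`, and (when `n ≥ 2`) either `m_{n-1} ≥ 2` or
`(m_{n-1}, m_n) = (1, 0)`. -/
def AnickChain (l : List ℕ) : Prop :=
  l ≠ [] ∧ (∀ j, j + 2 < l.length → 2 ≤ l.getD j 0) ∧
    (2 ≤ l.length →
      2 ≤ l.getD (l.length - 2) 0 ∨
        (l.getD (l.length - 2) 0 = 1 ∧ l.getD (l.length - 1) 0 = 0))

/-- The ℚ-vector space with basis the set of all Anick chains (of all lengths);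
its length-homogeneous components are the spaces `A_n`. -/
abbrev AnickSpace : Type := {l : List ℕ // AnickChain l} →₀ ℚ

open Classical in
/-- The basis element `[m_1|…|m_n]` attached to a list; by convention it is `0`
if the list is not an Anick chain. -/
noncomputable def br (l : List ℕ) : AnickSpace :=
  if h : AnickChain l then Finsupp.single ⟨l, h⟩ 1 else 0

/-- The `j`-th entry of a list, `1`-based (with default value 0). -/
def ent (l : List ℕ) (j : ℕ) : ℕ := l.getD (j - 1) 0

/-- Replace the pair of entries at (1-based) positions `j, j+1` by the single entry `c`. -/
def mergeAt (l : List ℕ) (j c : ℕ) : List ℕ := l.take (j - 1) ++ c :: l.drop (j + 1)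

/-- Decrease the (1-based) `t`-th entry by one. -/
def decAt (l : List ℕ) (t : ℕ) : List ℕ := l.set (t - 1) (ent l t - 1)

open Classical in
/-- The value of the Anick differential on the basis chain `[i_1|…|i_{n+1}]`. -/
noncomputable def deltaFun (l : List ℕ) : AnickSpace :=
  let n := l.length - 1
  let i : ℕ → ℚ := fun j => (ent l j : ℚ)
  if 2 ≤ ent l n then
    (∑ j ∈ Icc 1 n, ((-1 : ℚ) ^ j * (i j * (i j - 1) / (i j + i (j + 1) - 1))) •
        br (mergeAt l j (ent l j + ent l (j + 1) - 1)))
    + (∑ j ∈ Icc 2 n, ∑ t ∈ Icc 1 (j - 1),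
        ((-1 : ℚ) ^ j * (i t * (i j - 1) * (i (j + 1) - 1) / (i j + i (j + 1) - 1))) •
          br (mergeAt (decAt l t) j (ent l j + ent l (j + 1))))
    + (∑ j ∈ Icc 2 n, ∑ t ∈ Icc 1 (j - 1),
        ((-1 : ℚ) ^ j * (i j * i (j + 1) * (i t - 1) / (i j + i (j + 1) - 1))) •
          br (mergeAt l j (ent l j + ent l (j + 1) - 1)))
  else if ent l n = 1 ∧ ent l (n + 1) = 0 then
    (∑ j ∈ Icc 1 (n - 2), ((-1 : ℚ) ^ j * (i j * (i j - 1) / (i j + i (j + 1) - 1))) •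
        br (mergeAt l j (ent l j + ent l (j + 1) - 1)))
    + (∑ j ∈ Icc 2 (n - 2), ∑ t ∈ Icc 1 (j - 1),
        ((-1 : ℚ) ^ j * (i t * (i j - 1) * (i (j + 1) - 1) / (i j + i (j + 1) - 1))) •
          br (mergeAt (decAt l t) j (ent l j + ent l (j + 1))))
    + (∑ j ∈ Icc 2 (n - 2), ∑ t ∈ Icc 1 (j - 1),
        ((-1 : ℚ) ^ j * (i j * i (j + 1) * (i t - 1) / (i j + i (j + 1) - 1))) •
          br (mergeAt l j (ent l j + ent l (j + 1) - 1)))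
    + (∑ j ∈ Icc 1 (n - 1), ((-1 : ℚ) ^ n * i j) • br ((decAt l j).dropLast))
    + (∑ j ∈ Icc 1 (n - 1), ((-1 : ℚ) ^ (n - 1) * (i j - 1)) • br (l.take (n - 1) ++ [0]))
    + ((-1 : ℚ) ^ n • br (l.take (n - 1) ++ [0]))
  else 0

/-- The Anick differential `δ` (the direct sum of all the maps `δ_n`; on the
length-one component it vanishes, i.e. `δ_1 = 0`). -/
noncomputable def anickDelta : AnickSpace →ₗ[ℚ] AnickSpace :=
  Finsupp.linearCombination ℚ (fun c => deltaFun c.1)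

/-- The value of `∂̃` on a basis chain. -/
noncomputable def dtilFun (l : List ℕ) : AnickSpace :=
  ∑ j ∈ Finset.range l.length, (l.getD j 0 : ℚ) • br (l.set j (l.getD j 0 - 1))

/-- The derivation `∂̃` on the Anick complex. -/
noncomputable def dtil : AnickSpace →ₗ[ℚ] AnickSpace :=
  Finsupp.linearCombination ℚ (fun c => dtilFun c.1)

/-- `A_n`: the span of the Anick chains of length `n`. -/
noncomputable def A (n : ℕ) : Submodule ℚ AnickSpace :=
  Finsupp.supported ℚ ℚ {c | c.1.length = n}

/-- `A_{n,k}`: the span of the Anick chains of length `n` whose last entry is `≥ k`. -/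
noncomputable def Ak (n k : ℕ) : Submodule ℚ AnickSpace :=
  Finsupp.supported ℚ ℚ {c | c.1.length = n ∧ k ≤ c.1.getD (n - 1) 0}

/-- `A_n^{(d)}`: the span of the Anick chains of length `n` and degree `d`. -/
noncomputable def Adeg (n d : ℕ) : Submodule ℚ AnickSpace :=
  Finsupp.supported ℚ ℚ {c | c.1.length = n ∧ c.1.sum = d}

/-- `A_n^{(d)∘}`: the span of the regular Anick chains (all entries `≥ 2`) of
length `n` and degree `d`. -/
noncomputable def Areg (n d : ℕ) : Submodule ℚ AnickSpace :=
  Finsupp.supported ℚ ℚ {c | c.1.length = n ∧ c.1.sum = d ∧ ∀ j < n, 2 ≤ c.1.getD j 0}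

/-- `K_n = ker ∂̃_n ⊆ A_n`. -/
noncomputable def K (n : ℕ) : Submodule ℚ AnickSpace := A n ⊓ LinearMap.ker dtil

/-- `K_n^{(d)} = K_n ∩ A_n^{(d)}`. -/
noncomputable def Kdeg (n d : ℕ) : Submodule ℚ AnickSpace := K n ⊓ Adeg n d

open Classical in
/-- The component map `a ↦ a_i`: keep only the chains whose last entry is `i`
and delete that last entry. -/
noncomputable def component (i : ℕ) : AnickSpace →ₗ[ℚ] AnickSpace :=
  Finsupp.linearCombination ℚ
    (fun c => if c.1.getLast? = some i then br c.1.dropLast else 0)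

/-- The elements `e_1 = [1|0]` and `e_d = Σ_{s=0}^{d-2} (-1)^s C(d,s) [d-s|s]` for `d ≥ 3`. -/
noncomputable def eElt (d : ℕ) : AnickSpace :=
  if d = 1 then br [1, 0]
  else ∑ s ∈ Finset.range (d - 1), ((-1 : ℚ) ^ s * (d.choose s : ℚ)) • br [d - s, s]

theorem anickChain_singleton (m : ℕ) : AnickChain [m] := by
  simp [AnickChain]

theorem anickChain_append_pair (r : List ℕ) (m i : ℕ) :
    AnickChain (r ++ [m, i]) ↔ (∀ x ∈ r, 2 ≤ x) ∧ (2 ≤ m ∨ m = 1 ∧ i = 0) := by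
  have h : ∀ j, j + 2 < (r ++ [m, i]).length ↔ j < r.length := by simp
  have hr : (∀ j, j < r.length → 2 ≤ (r ++ [m, i]).getD j 0) ↔ ∀ x ∈ r, 2 ≤ x := by
    rw [List.forall_mem_iff_getElem]
    refine forall_congr' fun j => forall_congr' fun hj => ?_
    rw [List.getD_append _ _ _ _ hj, List.getD_eq_getElem _ _ hj]
  have hm : (r ++ [m, i]).getD ((r ++ [m, i]).length - 2) 0 = m := by simp
  have hi : (r ++ [m, i]).getD ((r ++ [m, i]).length - 1) 0 = i := by simp
  unfold AnickChain
  rw [hm, hi]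
  simp only [h, hr]
  simp

theorem AnickChain.of_append_singleton {q : List ℕ} {i : ℕ} (h : AnickChain (q ++ [i]))
    (hq : q ≠ []) : AnickChain q := by
  obtain ⟨r, m, rfl⟩ := List.eq_nil_or_concat' q |>.resolve_left hq
  rw [List.append_assoc, List.singleton_append, anickChain_append_pair] at h
  obtain rfl | ⟨s, k, rfl⟩ := List.eq_nil_or_concat' r
  · exact anickChain_singleton m
  · rw [List.append_assoc, List.singleton_append, anickChain_append_pair]
    exact ⟨fun x hx => h.1 x (by simp [hx]), Or.inl (h.1 k (by simp))⟩

theorem AnickChain.of_append_succ {q : List ℕ} {i : ℕ} (h : AnickChain (q ++ [i + 1])) :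
    AnickChain (q ++ [i]) := by
  obtain rfl | ⟨r, m, rfl⟩ := List.eq_nil_or_concat' q
  · exact anickChain_singleton i
  · simp only [List.append_assoc, List.singleton_append, anickChain_append_pair] at h ⊢
    exact ⟨h.1, Or.inl (by omega)⟩

open Classical in
/-- The coefficient of a list in an element of the Anick space, `0` on lists that are
not Anick chains. -/
noncomputable def coeff (l : List ℕ) : AnickSpace →ₗ[ℚ] ℚ :=
  if h : AnickChain l then Finsupp.lapply ⟨l, h⟩ else 0

theorem coeff_of_not_anickChain {l : List ℕ} (h : ¬AnickChain l) (a : AnickSpace) :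
    coeff l a = 0 := by
  simp [coeff, h]

theorem coeff_val (c : {l : List ℕ // AnickChain l}) (a : AnickSpace) : coeff c.1 a = a c := by
  simp [coeff, c.2]

theorem anickSpace_ext {a b : AnickSpace} (h : ∀ l, coeff l a = coeff l b) : a = b := by
  ext c
  rw [← coeff_val, ← coeff_val, h]

open Classical in
theorem coeff_single (l : List ℕ) (c : {l : List ℕ // AnickChain l}) (x : ℚ) :
    coeff l (Finsupp.single c x) = if l = c.1 then x else 0 := by
  by_cases h : AnickChain l
  · simp [coeff, h, Finsupp.single_apply, Subtype.ext_iff, eq_comm]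
  · rw [coeff_of_not_anickChain h, if_neg]
    rintro rfl
    exact h c.2

open Classical in
theorem coeff_br {l : List ℕ} (h : AnickChain l) (l' : List ℕ) :
    coeff l (br l') = if l = l' then 1 else 0 := by
  by_cases h' : AnickChain l'
  · simp [br, h', coeff_single]
  · rw [br, dif_neg h', map_zero, if_neg]
    rintro rfl
    exact h' h

theorem eq_set_pred_iff {l k : List ℕ} {j : ℕ} (hj : j < k.length) (hk : k.getD j 0 ≠ 0) :
    l = k.set j (k.getD j 0 - 1) ↔ l.set j (l.getD j 0 + 1) = k := by
  constructor
  · rintro rfl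
    rw [List.getD_eq_getElem _ _ hj] at hk
    have : k[j] - 1 + 1 = k[j] := by omega
    simp [hj, this]
  · rintro rfl
    simp only [List.length_set] at hj
    simp [hj]

theorem coeff_dtil {l : List ℕ} (h : AnickChain l) (a : AnickSpace) :
    coeff l (dtil a) =
      ∑ j ∈ range l.length, (l.getD j 0 + 1 : ℚ) * coeff (l.set j (l.getD j 0 + 1)) a := by
  classical
  induction a using Finsupp.induction_linear with
  | zero => simp
  | add a b ha hb => simp only [map_add, ha, hb, mul_add, sum_add_distrib]
  | single c x =>
    simp only [dtil, Finsupp.linearCombination_single, dtilFun, map_smul, map_sum, smul_eq_mul,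
      coeff_br h, coeff_single, mul_sum]
    by_cases hl : l.length = c.1.length
    · rw [hl]
      refine sum_congr rfl fun j hj => ?_
      have hj := mem_range.1 hj
      by_cases hc : c.1.getD j 0 = 0
      · rw [if_neg (c := _ = c.1), hc]
        · simp
        · intro he
          rw [← he] at hc
          simp [hl, hj] at hc
      · simp only [eq_set_pred_iff hj hc]
        split_ifs with he
        · have : c.1.getD j 0 = l.getD j 0 + 1 := by
            rw [← he]
            simp [hl, hj]
          rw [this]
          push_cast
          ring
        · simp
    · rw [sum_eq_zero, sum_eq_zero]
      · intro j _
        rw [if_neg, mul_zero]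
        intro he
        simp [← he] at hl
      · intro j _
        rw [if_neg, mul_zero, mul_zero]
        rintro rfl
        simp at hl

theorem coeff_dtil_append_singleton {q : List ℕ} {i : ℕ} (h : AnickChain (q ++ [i]))
    (a : AnickSpace) :
    coeff (q ++ [i]) (dtil a) =
      ∑ j ∈ range q.length, (q.getD j 0 + 1 : ℚ) * coeff (q.set j (q.getD j 0 + 1) ++ [i]) a
        + (i + 1) * coeff (q ++ [i + 1]) a := by
  rw [coeff_dtil h, List.length_append, List.length_singleton, sum_range_succ]
  congr 1
  · refine sum_congr rfl fun j hj => ?_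
    have hj := mem_range.1 hj
    rw [List.getD_append _ _ _ _ hj, List.set_append_left _ _ hj]
  · simp

theorem coeff_component {q : List ℕ} (hq : q ≠ []) (i : ℕ) (a : AnickSpace) :
    coeff q (component i a) = coeff (q ++ [i]) a := by
  classical
  by_cases h : AnickChain q
  · induction a using Finsupp.induction_linear with
    | zero => simp
    | add a b ha hb => simp only [map_add, ha, hb]
    | single c x =>
      simp only [component, Finsupp.linearCombination_single, map_smul, smul_eq_mul, coeff_single]
      obtain ⟨p, k, hp⟩ := List.eq_nil_or_concat' c.1 |>.resolve_left c.2.1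
      rw [hp]
      by_cases hk : k = i
      · subst hk
        simp [coeff_br h]
      · simp [hk, Ne.symm hk]
  · rw [coeff_of_not_anickChain h, coeff_of_not_anickChain fun h' => h (h'.of_append_singleton hq)]

theorem coeff_nil (a : AnickSpace) : coeff [] a = 0 :=
  coeff_of_not_anickChain (fun h => h.1 rfl) a

theorem component_zero_component_zero (a : AnickSpace) : component 0 (component 0 a) = 0 := by
  refine anickSpace_ext fun q => ?_
  rw [map_zero]
  by_cases hq : q = []
  · rw [hq, coeff_nil]
  · rw [coeff_component hq, coeff_component (by simp), coeff_of_not_anickChain]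
    simp [anickChain_append_pair]

theorem component_one_dtil_component_zero {a : AnickSpace} (ha : dtil a = 0) :
    component 1 (dtil (component 0 a)) = 0 := by
  refine anickSpace_ext fun q => ?_
  rw [map_zero]
  by_cases hq : q = []
  · rw [hq, coeff_nil]
  rw [coeff_component hq]
  by_cases h : AnickChain (q ++ [1])
  · have h0 : AnickChain (q ++ [1] ++ [0]) := by
      obtain ⟨r, m, rfl⟩ := List.eq_nil_or_concat' q |>.resolve_left hq
      rw [List.append_assoc, List.singleton_append, anickChain_append_pair] at h
      rw [List.append_assoc _ [1], List.singleton_append, anickChain_append_pair]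
      refine ⟨fun x hx => ?_, Or.inr ⟨rfl, rfl⟩⟩
      rcases List.mem_append.1 hx with hx | hx
      · exact h.1 x hx
      · rw [List.mem_singleton.1 hx]
        simpa using h.2
    have h1 : ¬AnickChain (q ++ [1] ++ [0 + 1]) := by simp [anickChain_append_pair]
    have key := coeff_dtil_append_singleton h0 a
    rw [ha, map_zero, coeff_of_not_anickChain h1, mul_zero, add_zero] at key
    rw [coeff_dtil h, key]
    refine sum_congr rfl fun j _ => ?_
    rw [coeff_component]
    simp
  · exact coeff_of_not_anickChain h _

theorem coeff_append_singleton_eq_zero {a : AnickSpace} (ha : dtil a = 0)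
    (h0 : component 0 a = 0) (i : ℕ) {q : List ℕ} (hq : q ≠ []) : coeff (q ++ [i]) a = 0 := by
  induction i generalizing q with
  | zero => rw [← coeff_component hq, h0, map_zero]
  | succ i ih =>
    by_cases h : AnickChain (q ++ [i + 1])
    · have key := coeff_dtil_append_singleton h.of_append_succ a
      rw [ha, map_zero, sum_eq_zero, zero_add, eq_comm, mul_eq_zero] at key
      · exact key.resolve_left (by positivity)
      · intro j _
        rw [ih, mul_zero]
        simpa [← List.length_pos_iff] using hq
    · exact coeff_of_not_anickChain h a

theorem eq_zero_of_mem_K {n : ℕ} (hn : 2 ≤ n) {a : AnickSpace} (ha : a ∈ K n)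
    (h0 : component 0 a = 0) : a = 0 := by
  ext c
  by_contra hc
  have hlen : c.1.length = n := ha.1 (Finsupp.mem_support_iff.2 hc)
  obtain ⟨q, i, hq⟩ := List.eq_nil_or_concat' c.1 |>.resolve_left c.2.1
  refine hc ?_
  rw [← coeff_val, hq]
  refine coeff_append_singleton_eq_zero ha.2 h0 i ?_
  rintro rfl
  simp [hq] at hlen
  omega

/-- for `n ≥ 2`, every `a ∈ K_n` satisfies `(a_0)_0 = 0` and
`(∂̃_{n-1}(a_0))_1 = 0`, and `a ↦ a_0` is injective on `K_n`. -/
theorem kernel_determined_by_zero_component (n : ℕ) (hn : 2 ≤ n) :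
    (∀ a ∈ K n,
      component 0 (component 0 a) = 0 ∧ component 1 (dtil (component 0 a)) = 0) ∧
    (∀ a ∈ K n, ∀ b ∈ K n, component 0 a = component 0 b → a = b) := by
  refine ⟨fun a ha => ⟨component_zero_component_zero a,
    component_one_dtil_component_zero ha.2⟩, fun a ha b hb hab => ?_⟩
  rw [← sub_eq_zero]
  exact eq_zero_of_mem_K hn (sub_mem ha hb) (by rw [map_sub, hab, sub_self])
end

section
/- The family {e_1} ∪ {e_d : d ≥ 3} is a ℚ-linear basis of K_2. -/
open Finset

theorem anickChain_pair {a b : ℕ} : AnickChain [a, b] ↔ 2 ≤ a ∨ (a = 1 ∧ b = 0) := by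
  simp [AnickChain]

theorem dtil_br_pair {a b : ℕ} (h : AnickChain [a, b]) :
    dtil (br [a, b]) = (a : ℚ) • br [a - 1, b] + (b : ℚ) • br [a, b - 1] := by
  rw [br, dif_pos h, dtil, Finsupp.linearCombination_single, one_smul, dtilFun]
  simp [Finset.sum_range_succ]

theorem br_pair_mem_A (a b : ℕ) : br [a, b] ∈ A 2 := by
  unfold br
  split_ifs
  · exact Finsupp.single_mem_supported ℚ 1 (by simp)
  · exact zero_mem _

open Classical in
/-- The coefficient of a list in an element of the Anick space, with value `0` if the list is
not an Anick chain. -/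
noncomputable def coeffAt (l : List ℕ) : AnickSpace →ₗ[ℚ] ℚ :=
  if h : AnickChain l then Finsupp.lapply ⟨l, h⟩ else 0

theorem coeffAt_apply {l : List ℕ} (h : AnickChain l) (x : AnickSpace) :
    coeffAt l x = x ⟨l, h⟩ := by
  simp [coeffAt, h]

theorem coeffAt_br {l : List ℕ} (h : AnickChain l) (l' : List ℕ) :
    coeffAt l (br l') = if l' = l then 1 else 0 := by
  rw [coeffAt_apply h, br]
  split_ifs with h₁ h₂ h₂
  · simp [h₂]
  · exact Finsupp.single_eq_of_ne (by simpa [Subtype.ext_iff, eq_comm] using h₂)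
  · exact absurd (h₂ ▸ h) h₁
  · rfl

theorem coeffAt_br' {l' : List ℕ} (h : AnickChain l') (l : List ℕ) :
    coeffAt l (br l') = if l' = l then 1 else 0 := by
  by_cases hl : AnickChain l
  · exact coeffAt_br hl l'
  · rw [coeffAt, dif_neg hl, if_neg (fun e : l' = l => hl (e ▸ h))]
    rfl

theorem coeffAt_dtil {a b : ℕ} (h : AnickChain [a, b]) {x : AnickSpace} (hx : x ∈ A 2) :
    coeffAt [a, b] (dtil x) =
      (a + 1) * coeffAt [a + 1, b] x + (b + 1) * coeffAt [a, b + 1] x := by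
  rw [A, Finsupp.supported_eq_span_single] at hx
  induction hx using Submodule.span_induction with
  | zero => simp
  | add x y _ _ hx hy => simp only [map_add, hx, hy]; ring
  | smul r x _ hx => simp only [map_smul, hx, smul_eq_mul]; ring
  | mem x hx =>
    obtain ⟨⟨l, hl⟩, hlen, rfl⟩ := hx
    obtain ⟨m, n, rfl⟩ := List.length_eq_two.mp hlen
    have hbr : Finsupp.single (⟨[m, n], hl⟩ : {l : List ℕ // AnickChain l}) (1 : ℚ) =
        br [m, n] := by rw [br, dif_pos hl]
    simp only [hbr, dtil_br_pair hl, map_add, map_smul, smul_eq_mul, coeffAt_br h,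
      coeffAt_br' hl, List.cons.injEq, and_true]
    congr 1
    · rcases m with _ | m
      · simp
      · by_cases hm : m = a <;> simp [hm]
    · rcases n with _ | n
      · simp
      · by_cases hn : n = b <;> simp [hn]

theorem eElt_of_three_le {d : ℕ} (hd : 3 ≤ d) :
    eElt d = ∑ s ∈ range (d - 1), ((-1 : ℚ) ^ s * (d.choose s : ℚ)) • br [d - s, s] :=
  if_neg (by omega)

theorem dtil_eElt {d : ℕ} (hd : d = 1 ∨ 3 ≤ d) : dtil (eElt d) = 0 := by
  rcases hd with rfl | hd
  · have h : ¬ AnickChain [0, 0] := by simp [anickChain_pair]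
    rw [eElt, if_pos rfl, dtil_br_pair (anickChain_pair.mpr (by simp))]
    simp [br, h]
  · set g : ℕ → AnickSpace := fun s =>
      ((-1 : ℚ) ^ s * (d.choose s : ℚ) * s) • br [d - s, s - 1] with hg
    have hterm : ∀ s ∈ range (d - 1),
        dtil (((-1 : ℚ) ^ s * (d.choose s : ℚ)) • br [d - s, s]) = g s - g (s + 1) := by
      intro s hs
      have hs : s < d - 1 := mem_range.mp hs
      have hchoose : (d.choose (s + 1) : ℚ) * (s + 1) = d.choose s * ((d - s : ℕ) : ℚ) := by
        exact_mod_cast Nat.choose_succ_right_eq d s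
      have hcoeff : (-1 : ℚ) ^ (s + 1) * (d.choose (s + 1) : ℚ) * ((s + 1 : ℕ) : ℚ) =
          -((-1 : ℚ) ^ s * (d.choose s : ℚ) * ((d - s : ℕ) : ℚ)) := by
        push_cast
        rw [mul_assoc, hchoose]
        ring
      simp only [hg]
      rw [map_smul, dtil_br_pair (anickChain_pair.mpr (by omega)), hcoeff,
        Nat.add_sub_cancel, Nat.sub_sub, smul_add, smul_smul, smul_smul, neg_smul]
      abel
    have hlast : ¬ AnickChain [d - (d - 1), d - 1 - 1] := by
      rw [anickChain_pair]; omega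
    rw [eElt_of_three_le hd, map_sum, sum_congr rfl hterm, sum_range_sub']
    simp [hg, br, hlast]

theorem eElt_mem_K {d : ℕ} (hd : d = 1 ∨ 3 ≤ d) : eElt d ∈ K 2 := by
  refine ⟨?_, dtil_eElt hd⟩
  unfold eElt
  split_ifs
  · exact br_pair_mem_A _ _
  · exact sum_mem fun s _ => Submodule.smul_mem _ _ (br_pair_mem_A _ _)

theorem coeffAt_eElt {c d : ℕ} (hc : c = 1 ∨ 3 ≤ c) (hd : d = 1 ∨ 3 ≤ d) :
    coeffAt [c, 0] (eElt d) = if d = c then 1 else 0 := by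
  have h : AnickChain [c, 0] := anickChain_pair.mpr (by omega)
  rcases hd with rfl | hd
  · simp [eElt, coeffAt_br h]
  · rw [eElt_of_three_le hd, map_sum, sum_eq_single_of_mem 0 (mem_range.mpr (by omega))]
    · simp [coeffAt_br h]
    · intro s _ hs
      simp [coeffAt_br h, hs]

/-- An element of `K_2` is determined by its coefficients at the chains `[d|0]`, `d ≠ 2`. -/
theorem eq_zero_of_mem_K_s7 {x : AnickSpace} (hx : x ∈ K 2)
    (h0 : ∀ d, d = 1 ∨ 3 ≤ d → coeffAt [d, 0] x = 0) : x = 0 := by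
  obtain ⟨hA, hker⟩ := hx
  have hrec : ∀ {a b : ℕ}, AnickChain [a, b] →
      (a + 1) * coeffAt [a + 1, b] x + (b + 1) * coeffAt [a, b + 1] x = 0 := by
    intro a b h
    rw [← coeffAt_dtil h hA, LinearMap.mem_ker.mp hker, map_zero]
  have h11 : ¬ AnickChain [1, 1] := by simp [anickChain_pair]
  have h2 : coeffAt [2, 0] x = 0 := by
    have h := hrec (a := 1) (b := 0) (anickChain_pair.mpr (by simp))
    simpa [coeffAt, h11] using h
  have hall : ∀ b a, AnickChain [a, b] → coeffAt [a, b] x = 0 := by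
    intro b
    induction b with
    | zero =>
      intro a h
      rw [anickChain_pair] at h
      by_cases ha : a = 2
      · exact ha ▸ h2
      · exact h0 a (by omega)
    | succ b ih =>
      intro a h
      rw [anickChain_pair] at h
      have h' := hrec (a := a) (b := b) (anickChain_pair.mpr (by omega))
      rw [ih (a + 1) (anickChain_pair.mpr (by omega)), mul_zero, zero_add] at h'
      exact (mul_eq_zero.mp h').resolve_left (by positivity)
  ext ⟨l, hl⟩
  by_cases hlen : l.length = 2
  · obtain ⟨a, b, rfl⟩ := List.length_eq_two.mp hlen
    rw [← coeffAt_apply hl, hall b a hl, Finsupp.zero_apply]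
  · exact Finsupp.notMem_support_iff.mp fun hmem => hlen (hA hmem)

/-- The chain `[d|0]`, for `d = 1` or `d ≥ 3`. -/
def headChain (t : {d : ℕ // d = 1 ∨ 3 ≤ d}) : {l : List ℕ // AnickChain l} :=
  ⟨[t.1, 0], anickChain_pair.mpr (by have := t.2; omega)⟩

theorem headChain_injective : Function.Injective headChain := by
  intro s t h
  simpa [headChain, Subtype.ext_iff] using h

/-- The coefficients of an element of `K_2` at the chains `[d|0]`, `d = 1` or `d ≥ 3`. -/
noncomputable def headCoeffs : K 2 →ₗ[ℚ] ({d : ℕ // d = 1 ∨ 3 ≤ d} →₀ ℚ) :=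
  Finsupp.lcomapDomain headChain headChain_injective ∘ₗ (K 2).subtype

theorem headCoeffs_apply (x : K 2) (t : {d : ℕ // d = 1 ∨ 3 ≤ d}) :
    headCoeffs x t = coeffAt [t.1, 0] x :=
  (coeffAt_apply (headChain t).2 x.1).symm

theorem headCoeffs_eElt (t : {d : ℕ // d = 1 ∨ 3 ≤ d}) :
    headCoeffs ⟨eElt t.1, eElt_mem_K t.2⟩ = Finsupp.single t 1 := by
  ext s
  rw [headCoeffs_apply, coeffAt_eElt s.2 t.2, Finsupp.single_apply]
  simp only [Subtype.ext_iff]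

theorem headCoeffs_bijective : Function.Bijective headCoeffs := by
  refine ⟨(injective_iff_map_eq_zero headCoeffs).mpr fun x hx => ?_, ?_⟩
  · refine Subtype.ext (eq_zero_of_mem_K_s7 x.2 fun d hd => ?_)
    rw [← headCoeffs_apply x ⟨d, hd⟩, hx, Finsupp.zero_apply]
  · intro f
    induction f using Finsupp.induction_linear with
    | zero => exact ⟨0, map_zero _⟩
    | add f g hf hg =>
      obtain ⟨x, rfl⟩ := hf
      obtain ⟨y, rfl⟩ := hg
      exact ⟨x + y, map_add _ _ _⟩
    | single t r =>
      exact ⟨r • ⟨eElt t.1, eElt_mem_K t.2⟩, by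
        rw [map_smul, headCoeffs_eElt, Finsupp.smul_single, smul_eq_mul, mul_one]⟩

/-- the family `{e_1} ∪ {e_d : d ≥ 3}` is a ℚ-linear basis of `K_2`. -/
theorem basis_of_K2 :
    ∃ B : Module.Basis {d : ℕ // d = 1 ∨ 3 ≤ d} ℚ (K 2), ∀ t, (B t : AnickSpace) = eElt t.1 := by
  refine ⟨.ofRepr (LinearEquiv.ofBijective headCoeffs headCoeffs_bijective), fun t => ?_⟩
  rw [Module.Basis.coe_ofRepr]
  refine congrArg Subtype.val ((LinearEquiv.symm_apply_eq _).mpr ?_ :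
    _ = (⟨eElt t.1, eElt_mem_K t.2⟩ : K 2))
  exact (headCoeffs_eElt t).symm
end

section
/- Let n ≥ 2 and let u ∈ A_{n,2} satisfy δ_n(u) = 0. Then there exists w ∈ A_{n+1,2} such that δ_{n+1}(w) = u. -/
open Finset

/-! ### Chains with all entries at least two -/

lemma anickChain_of_two_le {l : List ℕ} (hne : l ≠ []) (h : ∀ x ∈ l, 2 ≤ x) : AnickChain l := by
  refine ⟨hne, fun j hj => ?_, fun hl => Or.inl ?_⟩
  · rw [List.getD_eq_getElem _ _ (by omega)]
    exact h _ (List.getElem_mem _)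
  · rw [List.getD_eq_getElem _ _ (by omega)]
    exact h _ (List.getElem_mem _)

lemma AnickChain.two_le_of_last {l : List ℕ} (hc : AnickChain l)
    (hlast : 2 ≤ l.getD (l.length - 1) 0) : ∀ x ∈ l, 2 ≤ x := by
  obtain ⟨-, h1, h2⟩ := hc
  intro x hx
  obtain ⟨j, hj, rfl⟩ := List.getElem_of_mem hx
  rw [← List.getD_eq_getElem l 0 hj]
  rcases lt_trichotomy (j + 2) l.length with h | h | h
  · exact h1 j h
  · obtain rfl : j = l.length - 2 := by omega
    rcases h2 (by omega) with h3 | h3 <;> omega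
  · obtain rfl : j = l.length - 1 := by omega
    exact hlast

/-- The tail of an Anick chain is an Anick chain. -/
lemma AnickChain.tail {a : ℕ} {l : List ℕ} (hne : l ≠ []) (h : AnickChain (a :: l)) :
    AnickChain l := by
  obtain ⟨-, h1, h2⟩ := h
  refine ⟨hne, fun j hj => ?_, fun hl => ?_⟩
  · simpa using h1 (j + 1) (by simpa using by omega)
  · obtain ⟨k, hk⟩ : ∃ k, l.length = k + 2 := ⟨l.length - 2, by omega⟩
    have := h2 (by simp [hk])
    simpa [hk] using this

/-- Whether a list is an Anick chain does not depend on its first entry, once this is at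
least two. -/
lemma AnickChain.change_head {a b : ℕ} (hb : 2 ≤ b) {l : List ℕ}
    (h : AnickChain (a :: l)) : AnickChain (b :: l) := by
  obtain ⟨-, h1, h2⟩ := h
  refine ⟨by simp, fun j hj => ?_, fun hl => ?_⟩
  · cases j with
    | zero => simpa using hb
    | succ j => simpa using h1 (j + 1) (by simpa using hj)
  · have h3 := h2 (by simpa using hl)
    rcases l with - | ⟨c, - | ⟨d, l⟩⟩
    · simp at hl
    · simp [hb]
    · simpa using h3

lemma br_of_not {l : List ℕ} (h : ¬ AnickChain l) : br l = 0 := by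
  simp [br, h]

lemma br_of_chain {l : List ℕ} (h : AnickChain l) : br l = Finsupp.single ⟨l, h⟩ 1 := by
  simp [br, h]

lemma linearCombination_br (f : {l : List ℕ // AnickChain l} → AnickSpace) {l : List ℕ}
    (h : AnickChain l) : Finsupp.linearCombination ℚ f (br l) = f ⟨l, h⟩ := by
  simp [br_of_chain h]

lemma br_mem_Ak {n : ℕ} {l : List ℕ} (hl : l.length = n) (h : ∀ x ∈ l, 2 ≤ x) :
    br l ∈ Ak n 2 := by
  by_cases hne : l = []
  · rw [br_of_not (by simp [hne, AnickChain])]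
    exact zero_mem _
  · subst hl
    rw [br_of_chain (anickChain_of_two_le hne h)]
    refine Finsupp.single_mem_supported _ _ ⟨rfl, ?_⟩
    change 2 ≤ l.getD (l.length - 1) 0
    have : 0 < l.length := List.length_pos_iff.2 hne
    rw [List.getD_eq_getElem _ _ (by omega)]
    exact h _ (List.getElem_mem _)

/-- `A_{n,2}` is spanned by the chains of length `n` with all entries at least two. -/
lemma Ak_le {n : ℕ} {S : Submodule ℚ AnickSpace}
    (h : ∀ l : List ℕ, l ≠ [] → l.length = n → (∀ x ∈ l, 2 ≤ x) → br l ∈ S) :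
    Ak n 2 ≤ S := by
  rw [Ak, Finsupp.supported_eq_span_single, Submodule.span_le]
  rintro _ ⟨⟨l, hc⟩, ⟨hl, hlast⟩, rfl⟩
  have := h l hc.1 hl (hc.two_le_of_last (by simpa [hl] using hlast))
  rwa [br_of_chain hc] at this

/-! ### Operators on the first entry -/

/-- Prepend the entry `a` to every chain. -/
noncomputable def consMap (a : ℕ) : AnickSpace →ₗ[ℚ] AnickSpace :=
  Finsupp.linearCombination ℚ (fun c => br (a :: c.1))

lemma consMap_br (a : ℕ) {l : List ℕ} (hne : l ≠ []) : consMap a (br l) = br (a :: l) := by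
  by_cases h : AnickChain l
  · exact linearCombination_br _ h
  · rw [br_of_not h, map_zero, br_of_not fun h' => h (h'.tail hne)]

lemma consMap_mem {a n : ℕ} (ha : 2 ≤ a) {z : AnickSpace} (hz : z ∈ Ak n 2) :
    consMap a z ∈ Ak (n + 1) 2 := by
  suffices h : Ak n 2 ≤ (Ak (n + 1) 2).comap (consMap a) from h hz
  refine Ak_le fun l hne hl h => ?_
  rw [Submodule.mem_comap, consMap_br a hne]
  exact br_mem_Ak (by simp [hl]) (by simpa [ha] using h)

lemma consMap_one {n : ℕ} {z : AnickSpace} (hz : z ∈ Ak n 2) : consMap 1 z = 0 := by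
  suffices h : Ak n 2 ≤ LinearMap.ker (consMap 1) from h hz
  refine Ak_le fun l hne hl h => ?_
  rw [LinearMap.mem_ker, consMap_br 1 hne, br_of_not]
  rintro ⟨-, h1, h2⟩
  rcases l with - | ⟨b, - | ⟨c, l⟩⟩
  · exact hne rfl
  · simp at h2 h
    omega
  · simpa using h1 0 (by simp)

/-- The product with `[2]` on the left: `[j|…] ↦ 2/(j+1) [j+1|…]`. -/
noncomputable def raiseHead : AnickSpace →ₗ[ℚ] AnickSpace :=
  Finsupp.linearCombination ℚ
    (fun c => (2 / ((c.1.headD 0 : ℚ) + 1)) • br ((c.1.headD 0 + 1) :: c.1.tail))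

lemma raiseHead_br {a : ℕ} (ha : 2 ≤ a) (l : List ℕ) :
    raiseHead (br (a :: l)) = (2 / ((a : ℚ) + 1)) • br ((a + 1) :: l) := by
  by_cases h : AnickChain (a :: l)
  · exact linearCombination_br _ h
  · rw [br_of_not h, map_zero, br_of_not fun h' => h (h'.change_head ha), smul_zero]

lemma raiseHead_consMap {a n : ℕ} (ha : 2 ≤ a) {z : AnickSpace} (hz : z ∈ Ak n 2) :
    raiseHead (consMap a z) = (2 / ((a : ℚ) + 1)) • consMap (a + 1) z := by
  suffices h : Ak n 2 ≤
      LinearMap.eqLocus (raiseHead ∘ₗ consMap a) ((2 / ((a : ℚ) + 1)) • consMap (a + 1)) from h hz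
  refine Ak_le fun l hne hl h => ?_
  simp [LinearMap.mem_eqLocus, consMap_br _ hne, raiseHead_br ha]

/-- A left inverse of `raiseHead`, vanishing on the chains that start with `2`. -/
noncomputable def lowerHead : AnickSpace →ₗ[ℚ] AnickSpace :=
  Finsupp.linearCombination ℚ
    (fun c => if 3 ≤ c.1.headD 0 then
      ((c.1.headD 0 : ℚ) / 2) • br ((c.1.headD 0 - 1) :: c.1.tail) else 0)

lemma lowerHead_br {a : ℕ} {l : List ℕ} (h : AnickChain (a :: l)) :
    lowerHead (br (a :: l)) = if 3 ≤ a then ((a : ℚ) / 2) • br ((a - 1) :: l) else 0 :=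
  linearCombination_br _ h

lemma lowerHead_raiseHead {n : ℕ} {z : AnickSpace} (hz : z ∈ Ak n 2) :
    lowerHead (raiseHead z) = z := by
  suffices h : Ak n 2 ≤ LinearMap.eqLocus (lowerHead ∘ₗ raiseHead) LinearMap.id from h hz
  refine Ak_le fun l hne hl h => ?_
  rcases l with - | ⟨a, l⟩
  · exact absurd rfl hne
  have ha : 2 ≤ a := h a (by simp)
  have hc : AnickChain ((a + 1) :: l) :=
    (anickChain_of_two_le hne h).change_head (by omega)
  have ha' : (a : ℚ) + 1 ≠ 0 := by positivity
  simp only [LinearMap.mem_eqLocus, LinearMap.comp_apply, LinearMap.id_apply]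
  rw [raiseHead_br ha, map_smul, lowerHead_br hc, if_pos (by omega), smul_smul,
    Nat.add_sub_cancel]
  push_cast
  rw [show 2 / ((a : ℚ) + 1) * ((a + 1) / 2) = 1 by field_simp, one_smul]

lemma lowerHead_mem {n : ℕ} {z : AnickSpace} (hz : z ∈ Ak n 2) : lowerHead z ∈ Ak n 2 := by
  suffices h : Ak n 2 ≤ (Ak n 2).comap lowerHead from h hz
  refine Ak_le fun l hne hl h => ?_
  rcases l with - | ⟨a, l⟩
  · exact absurd rfl hne
  rw [Submodule.mem_comap, lowerHead_br (anickChain_of_two_le hne h)]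
  simp only [List.mem_cons, forall_eq_or_imp] at h
  split_ifs with ha
  · refine Submodule.smul_mem _ _ (br_mem_Ak (by simpa using hl) ?_)
    simp only [List.mem_cons, forall_eq_or_imp]
    exact ⟨by omega, h.2⟩
  · exact zero_mem _

lemma lowerHead_consMap_two (z : AnickSpace) : lowerHead (consMap 2 z) = 0 := by
  suffices h : lowerHead ∘ₗ consMap 2 = 0 from LinearMap.congr_fun h z
  refine Finsupp.lhom_ext' fun ⟨l, hl⟩ => LinearMap.ext_ring ?_
  simp only [LinearMap.comp_apply, Finsupp.lsingle_apply, LinearMap.zero_apply,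
    ← br_of_chain hl, consMap_br 2 hl.1]
  by_cases h : AnickChain (2 :: l)
  · simp [lowerHead_br h]
  · simp [br_of_not h]

/-- An element `z` of `A_{n,2}` splits off a part spanned by chains starting with `2`;
the rest is determined by `lowerHead z`. -/
lemma exists_consMap_two {n : ℕ} (hn : 1 ≤ n) {z : AnickSpace} (hz : z ∈ Ak (n + 1) 2) :
    ∃ y ∈ Ak n 2, z = raiseHead (lowerHead z) + consMap 2 y := by
  suffices h : Ak (n + 1) 2 ≤ ((Ak n 2).map (consMap 2)).comap
      (LinearMap.id - raiseHead ∘ₗ lowerHead) by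
    obtain ⟨y, hy, hyz⟩ := h hz
    refine ⟨y, hy, ?_⟩
    rw [hyz]
    simp
  refine Ak_le fun l hne hl h => ?_
  rcases l with - | ⟨a, l⟩
  · exact absurd rfl hne
  have ha : 2 ≤ a := h a (by simp)
  simp only [Submodule.mem_comap, LinearMap.sub_apply, LinearMap.id_apply, LinearMap.comp_apply]
  rw [lowerHead_br (anickChain_of_two_le hne h)]
  split_ifs with ha3
  · have ha' : (a : ℚ) ≠ 0 := by positivity
    rw [map_smul, raiseHead_br (by omega), Nat.sub_add_cancel (by omega), smul_smul,
      Nat.cast_sub (by omega), Nat.cast_one, sub_add_cancel,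
      show (a : ℚ) / 2 * (2 / a) = 1 by field_simp, one_smul, sub_self]
    exact zero_mem _
  · obtain rfl : a = 2 := by omega
    have hl' : l.length = n := by simpa using hl
    have hne' : l ≠ [] := by rintro rfl; simp at hl'; omega
    rw [map_zero, sub_zero]
    exact ⟨br l, br_mem_Ak hl' fun x hx => h x (by simp [hx]), consMap_br 2 hne'⟩

/-! ### The recursive description of the differential -/

lemma ent_cons_succ (a : ℕ) (l : List ℕ) {j : ℕ} (hj : 1 ≤ j) : ent (a :: l) (j + 1) = ent l j := by
  obtain ⟨j, rfl⟩ := Nat.exists_eq_add_of_le' hj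
  simp [ent]

lemma mergeAt_cons_succ (a : ℕ) (l : List ℕ) {j : ℕ} (hj : 1 ≤ j) (c : ℕ) :
    mergeAt (a :: l) (j + 1) c = a :: mergeAt l j c := by
  obtain ⟨j, rfl⟩ := Nat.exists_eq_add_of_le' hj
  simp [mergeAt]

lemma decAt_cons_succ (a : ℕ) (l : List ℕ) {j : ℕ} (hj : 1 ≤ j) :
    decAt (a :: l) (j + 1) = a :: decAt l j := by
  obtain ⟨j, rfl⟩ := Nat.exists_eq_add_of_le' hj
  simp [decAt, ent]

lemma decAt_cons_one (a : ℕ) (l : List ℕ) : decAt (a :: l) 1 = (a - 1) :: l := by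
  simp [decAt, ent]

lemma mergeAt_ne_nil (l : List ℕ) (j c : ℕ) : mergeAt l j c ≠ [] := by
  simp [mergeAt]

lemma two_le_ent {l : List ℕ} (h : ∀ x ∈ l, 2 ≤ x) {j : ℕ} (hj : j - 1 < l.length) :
    2 ≤ ent l j := by
  rw [ent, List.getD_eq_getElem _ _ hj]
  exact h _ (List.getElem_mem _)

lemma br_mergeAt_mem {n : ℕ} {l : List ℕ} (hl : l.length = n + 1) (h : ∀ x ∈ l, 2 ≤ x)
    {j c : ℕ} (hj : j ∈ Icc 1 n) (hc : 2 ≤ c) : br (mergeAt l j c) ∈ Ak n 2 := by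
  rw [mem_Icc] at hj
  refine br_mem_Ak ?_ fun x hx => ?_
  · simp [mergeAt, hl]
    omega
  · simp only [mergeAt, List.mem_append, List.mem_cons] at hx
    rcases hx with hx | rfl | hx
    · exact h x (List.mem_of_mem_take hx)
    · exact hc
    · exact h x (List.mem_of_mem_drop hx)

/-- The alternating sum of the products `[i|j] ↦ (i-1)(j-1)/(i+j-1) [i+j]` of neighbours. -/
noncomputable def qFun (l : List ℕ) : AnickSpace :=
  ∑ j ∈ Icc 1 (l.length - 1), ((-1 : ℚ) ^ j *
    (((ent l j : ℚ) - 1) * ((ent l (j + 1) : ℚ) - 1) / ((ent l j : ℚ) + ent l (j + 1) - 1))) •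
      br (mergeAt l j (ent l j + ent l (j + 1)))

/-- The alternating sum of the products `[i|j] ↦ ij/(i+j-1) [i+j-1]` of neighbours. -/
noncomputable def rFun (l : List ℕ) : AnickSpace :=
  ∑ j ∈ Icc 1 (l.length - 1), ((-1 : ℚ) ^ j *
    ((ent l j : ℚ) * (ent l (j + 1) : ℚ) / ((ent l j : ℚ) + ent l (j + 1) - 1))) •
      br (mergeAt l j (ent l j + ent l (j + 1) - 1))

/-- The linear extension of `rFun`. -/
noncomputable def rMap : AnickSpace →ₗ[ℚ] AnickSpace :=
  Finsupp.linearCombination ℚ (fun c => rFun c.1)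

lemma qFun_mem {n : ℕ} {l : List ℕ} (hl : l.length = n + 1) (h : ∀ x ∈ l, 2 ≤ x) :
    qFun l ∈ Ak n 2 := by
  refine Submodule.sum_mem _ fun j hj => Submodule.smul_mem _ _ ?_
  rw [hl, Nat.add_sub_cancel] at hj
  have := two_le_ent h (j := j) (by rw [mem_Icc] at hj; omega)
  exact br_mergeAt_mem hl h hj (by omega)

lemma rFun_mem {n : ℕ} {l : List ℕ} (hl : l.length = n + 1) (h : ∀ x ∈ l, 2 ≤ x) :
    rFun l ∈ Ak n 2 := by
  refine Submodule.sum_mem _ fun j hj => Submodule.smul_mem _ _ ?_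
  rw [hl, Nat.add_sub_cancel] at hj
  have h1 := two_le_ent h (j := j) (by rw [mem_Icc] at hj; omega)
  have h2 := two_le_ent h (j := j + 1) (by rw [mem_Icc] at hj; omega)
  exact br_mergeAt_mem hl h hj (by omega)

lemma sum_Icc_one_succ {M : Type*} [AddCommMonoid M] (f : ℕ → M) (k : ℕ) :
    ∑ j ∈ Icc 1 (k + 1), f j = f 1 + ∑ j ∈ Icc 1 k, f (j + 1) := by
  induction k with
  | zero => simp
  | succ k ih => rw [sum_Icc_succ_top (by omega), ih, sum_Icc_succ_top (by omega), add_assoc]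

lemma sum_Icc_two_triangle {M : Type*} [AddCommMonoid M] (f : ℕ → ℕ → M) (k : ℕ) :
    ∑ j ∈ Icc 2 (k + 1), ∑ t ∈ Icc 1 (j - 1), f j t =
      ∑ j ∈ Icc 1 k, f (j + 1) 1 + ∑ j ∈ Icc 2 k, ∑ t ∈ Icc 1 (j - 1), f (j + 1) (t + 1) := by
  induction k with
  | zero => simp
  | succ k ih =>
    rw [sum_Icc_succ_top (by omega), ih, sum_Icc_succ_top (by omega)]
    rcases k with - | k
    · simp
    · rw [sum_Icc_succ_top (b := k + 1) (by omega), Nat.add_sub_cancel,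
        sum_Icc_one_succ (f (k + 1 + 1 + 1)), Nat.add_sub_cancel]
      abel

lemma rFun_cons (a b : ℕ) (w : List ℕ) :
    rFun (a :: b :: w) =
      -((a : ℚ) * b / (a + b - 1)) • br ((a + b - 1) :: w) - consMap a (rFun (b :: w)) := by
  simp only [rFun, List.length_cons, Nat.add_sub_cancel, map_sum, map_smul]
  rw [sum_Icc_one_succ, sub_eq_add_neg (_ : AnickSpace), ← sum_neg_distrib]
  congr 1
  · simp [ent, mergeAt]
  · refine sum_congr rfl fun j hj => ?_
    have hj1 := (mem_Icc.1 hj).1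
    rw [ent_cons_succ _ _ hj1, ent_cons_succ a (b :: w) (j := j + 1) (by omega), mergeAt_cons_succ _ _ hj1,
      consMap_br _ (mergeAt_ne_nil _ _ _), ← neg_smul]
    congr 1
    ring

lemma deltaFun_of_two_le {l : List ℕ} (h : 2 ≤ ent l (l.length - 1)) :
    deltaFun l =
      (∑ j ∈ Icc 1 (l.length - 1), ((-1 : ℚ) ^ j *
          ((ent l j : ℚ) * ((ent l j : ℚ) - 1) / ((ent l j : ℚ) + ent l (j + 1) - 1))) •
          br (mergeAt l j (ent l j + ent l (j + 1) - 1)))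
      + (∑ j ∈ Icc 2 (l.length - 1), ∑ t ∈ Icc 1 (j - 1),
          ((-1 : ℚ) ^ j * ((ent l t : ℚ) * ((ent l j : ℚ) - 1) * ((ent l (j + 1) : ℚ) - 1) /
            ((ent l j : ℚ) + ent l (j + 1) - 1))) •
          br (mergeAt (decAt l t) j (ent l j + ent l (j + 1))))
      + (∑ j ∈ Icc 2 (l.length - 1), ∑ t ∈ Icc 1 (j - 1),
          ((-1 : ℚ) ^ j * ((ent l j : ℚ) * (ent l (j + 1) : ℚ) * ((ent l t : ℚ) - 1) /
            ((ent l j : ℚ) + ent l (j + 1) - 1))) •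
          br (mergeAt l j (ent l j + ent l (j + 1) - 1))) := by
  simp only [deltaFun, if_pos h]

lemma deltaFun_singleton {a : ℕ} (ha : 2 ≤ a) : deltaFun [a] = 0 := by
  rw [deltaFun_of_two_le (by simpa [ent] using ha)]
  simp

lemma deltaFun_cons {a b : ℕ} {w : List ℕ} (h : ∀ x ∈ a :: b :: w, 2 ≤ x) :
    deltaFun (a :: b :: w) =
      -((a : ℚ) * (a - 1) / (a + b - 1)) • br ((a + b - 1) :: w)
        - consMap a (deltaFun (b :: w)) - (a : ℚ) • consMap (a - 1) (qFun (b :: w))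
        - ((a : ℚ) - 1) • consMap a (rFun (b :: w)) := by
  have h' : ∀ x ∈ b :: w, 2 ≤ x := fun x hx => h x (by simp [hx])
  rw [deltaFun_of_two_le (two_le_ent h (by simp only [List.length_cons]; omega)),
    deltaFun_of_two_le (two_le_ent h' (by simp only [List.length_cons]; omega))]
  simp only [qFun, rFun, List.length_cons, Nat.add_sub_cancel, map_add, map_sum, map_smul]
  rw [sum_Icc_one_succ, sum_Icc_two_triangle, sum_Icc_two_triangle]
  have hP : ∀ j ∈ Icc 1 w.length,
      ((-1 : ℚ) ^ (j + 1) * ((ent (a :: b :: w) (j + 1) : ℚ) *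
        ((ent (a :: b :: w) (j + 1) : ℚ) - 1) /
        ((ent (a :: b :: w) (j + 1) : ℚ) + ent (a :: b :: w) (j + 1 + 1) - 1))) •
        br (mergeAt (a :: b :: w) (j + 1)
          (ent (a :: b :: w) (j + 1) + ent (a :: b :: w) (j + 1 + 1) - 1)) =
      -(((-1 : ℚ) ^ j * ((ent (b :: w) j : ℚ) * ((ent (b :: w) j : ℚ) - 1) /
        ((ent (b :: w) j : ℚ) + ent (b :: w) (j + 1) - 1))) •
        consMap a (br (mergeAt (b :: w) j (ent (b :: w) j + ent (b :: w) (j + 1) - 1)))) := by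
    intro j hj
    have hj1 := (mem_Icc.1 hj).1
    rw [ent_cons_succ _ _ hj1, ent_cons_succ a (b :: w) (j := j + 1) (by omega), mergeAt_cons_succ _ _ hj1,
      consMap_br _ (mergeAt_ne_nil _ _ _), ← neg_smul]
    congr 1
    ring
  have hQ1 : ∀ j ∈ Icc 1 w.length,
      ((-1 : ℚ) ^ (j + 1) * ((ent (a :: b :: w) 1 : ℚ) *
        ((ent (a :: b :: w) (j + 1) : ℚ) - 1) * ((ent (a :: b :: w) (j + 1 + 1) : ℚ) - 1) /
        ((ent (a :: b :: w) (j + 1) : ℚ) + ent (a :: b :: w) (j + 1 + 1) - 1))) •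
        br (mergeAt (decAt (a :: b :: w) 1) (j + 1)
          (ent (a :: b :: w) (j + 1) + ent (a :: b :: w) (j + 1 + 1))) =
      -((a : ℚ) • ((-1 : ℚ) ^ j * (((ent (b :: w) j : ℚ) - 1) *
        ((ent (b :: w) (j + 1) : ℚ) - 1) /
        ((ent (b :: w) j : ℚ) + ent (b :: w) (j + 1) - 1))) •
        consMap (a - 1) (br (mergeAt (b :: w) j (ent (b :: w) j + ent (b :: w) (j + 1))))) := by
    intro j hj
    have hj1 := (mem_Icc.1 hj).1
    rw [ent_cons_succ _ _ hj1, ent_cons_succ a (b :: w) (j := j + 1) (by omega), decAt_cons_one,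
      mergeAt_cons_succ _ _ hj1, consMap_br _ (mergeAt_ne_nil _ _ _), smul_smul, ← neg_smul]
    congr 1
    simp only [ent, Nat.sub_self, List.getD_cons_zero]
    ring
  have hR1 : ∀ j ∈ Icc 1 w.length,
      ((-1 : ℚ) ^ (j + 1) * ((ent (a :: b :: w) (j + 1) : ℚ) *
        (ent (a :: b :: w) (j + 1 + 1) : ℚ) * ((ent (a :: b :: w) 1 : ℚ) - 1) /
        ((ent (a :: b :: w) (j + 1) : ℚ) + ent (a :: b :: w) (j + 1 + 1) - 1))) •
        br (mergeAt (a :: b :: w) (j + 1)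
          (ent (a :: b :: w) (j + 1) + ent (a :: b :: w) (j + 1 + 1) - 1)) =
      -(((a : ℚ) - 1) • ((-1 : ℚ) ^ j * ((ent (b :: w) j : ℚ) * (ent (b :: w) (j + 1) : ℚ) /
        ((ent (b :: w) j : ℚ) + ent (b :: w) (j + 1) - 1))) •
        consMap a (br (mergeAt (b :: w) j (ent (b :: w) j + ent (b :: w) (j + 1) - 1)))) := by
    intro j hj
    have hj1 := (mem_Icc.1 hj).1
    rw [ent_cons_succ _ _ hj1, ent_cons_succ a (b :: w) (j := j + 1) (by omega),
      mergeAt_cons_succ _ _ hj1, consMap_br _ (mergeAt_ne_nil _ _ _), smul_smul, ← neg_smul]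
    congr 1
    simp only [ent, Nat.sub_self, List.getD_cons_zero]
    ring
  have hQ : ∀ j ∈ Icc 2 w.length, ∀ t ∈ Icc 1 (j - 1),
      ((-1 : ℚ) ^ (j + 1) * ((ent (a :: b :: w) (t + 1) : ℚ) *
        ((ent (a :: b :: w) (j + 1) : ℚ) - 1) * ((ent (a :: b :: w) (j + 1 + 1) : ℚ) - 1) /
        ((ent (a :: b :: w) (j + 1) : ℚ) + ent (a :: b :: w) (j + 1 + 1) - 1))) •
        br (mergeAt (decAt (a :: b :: w) (t + 1)) (j + 1)
          (ent (a :: b :: w) (j + 1) + ent (a :: b :: w) (j + 1 + 1))) =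
      -(((-1 : ℚ) ^ j * ((ent (b :: w) t : ℚ) * ((ent (b :: w) j : ℚ) - 1) *
        ((ent (b :: w) (j + 1) : ℚ) - 1) /
        ((ent (b :: w) j : ℚ) + ent (b :: w) (j + 1) - 1))) •
        consMap a (br (mergeAt (decAt (b :: w) t) j
          (ent (b :: w) j + ent (b :: w) (j + 1))))) := by
    intro j hj t ht
    have hj1 : 1 ≤ j := by have := (mem_Icc.1 hj).1; omega
    have ht1 := (mem_Icc.1 ht).1
    rw [ent_cons_succ _ _ hj1, ent_cons_succ a (b :: w) (j := j + 1) (by omega), ent_cons_succ _ _ ht1,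
      decAt_cons_succ _ _ ht1, mergeAt_cons_succ _ _ hj1, consMap_br _ (mergeAt_ne_nil _ _ _),
      ← neg_smul]
    congr 1
    ring
  have hR : ∀ j ∈ Icc 2 w.length, ∀ t ∈ Icc 1 (j - 1),
      ((-1 : ℚ) ^ (j + 1) * ((ent (a :: b :: w) (j + 1) : ℚ) *
        (ent (a :: b :: w) (j + 1 + 1) : ℚ) * ((ent (a :: b :: w) (t + 1) : ℚ) - 1) /
        ((ent (a :: b :: w) (j + 1) : ℚ) + ent (a :: b :: w) (j + 1 + 1) - 1))) •
        br (mergeAt (a :: b :: w) (j + 1)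
          (ent (a :: b :: w) (j + 1) + ent (a :: b :: w) (j + 1 + 1) - 1)) =
      -(((-1 : ℚ) ^ j * ((ent (b :: w) j : ℚ) * (ent (b :: w) (j + 1) : ℚ) *
        ((ent (b :: w) t : ℚ) - 1) /
        ((ent (b :: w) j : ℚ) + ent (b :: w) (j + 1) - 1))) •
        consMap a (br (mergeAt (b :: w) j (ent (b :: w) j + ent (b :: w) (j + 1) - 1)))) := by
    intro j hj t ht
    have hj1 : 1 ≤ j := by have := (mem_Icc.1 hj).1; omega
    have ht1 := (mem_Icc.1 ht).1
    rw [ent_cons_succ _ _ hj1, ent_cons_succ a (b :: w) (j := j + 1) (by omega), ent_cons_succ _ _ ht1,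
      mergeAt_cons_succ _ _ hj1, consMap_br _ (mergeAt_ne_nil _ _ _), ← neg_smul]
    congr 1
    ring
  rw [sum_congr rfl hP, sum_congr rfl hQ1, sum_congr rfl hR1,
    sum_congr rfl fun j hj => sum_congr rfl (hQ j hj),
    sum_congr rfl fun j hj => sum_congr rfl (hR j hj)]
  simp only [sum_neg_distrib, ← smul_sum]
  have hhead : ((-1 : ℚ) ^ 1 * ((ent (a :: b :: w) 1 : ℚ) * ((ent (a :: b :: w) 1 : ℚ) - 1) /
      ((ent (a :: b :: w) 1 : ℚ) + ent (a :: b :: w) (1 + 1) - 1))) •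
      br (mergeAt (a :: b :: w) 1 (ent (a :: b :: w) 1 + ent (a :: b :: w) (1 + 1) - 1)) =
      -((a : ℚ) * (a - 1) / (a + b - 1)) • br ((a + b - 1) :: w) := by
    simp [ent, mergeAt]
  rw [hhead]
  abel

lemma anickDelta_br {l : List ℕ} (h : AnickChain l) : anickDelta (br l) = deltaFun l :=
  linearCombination_br _ h

lemma rMap_br {l : List ℕ} (h : AnickChain l) : rMap (br l) = rFun l :=
  linearCombination_br _ h

lemma rMap_mem {n : ℕ} {z : AnickSpace} (hz : z ∈ Ak (n + 1) 2) : rMap z ∈ Ak n 2 := by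
  suffices h : Ak (n + 1) 2 ≤ (Ak n 2).comap rMap from h hz
  refine Ak_le fun l hne hl h => ?_
  rw [Submodule.mem_comap, rMap_br (anickChain_of_two_le hne h)]
  exact rFun_mem hl h

lemma deltaFun_mem {n : ℕ} {l : List ℕ} (hl : l.length = n + 1) (h : ∀ x ∈ l, 2 ≤ x) :
    deltaFun l ∈ Ak n 2 := by
  induction l generalizing n with
  | nil => simp at hl
  | cons a v ih =>
    have ha : 2 ≤ a := h a (by simp)
    rcases v with - | ⟨b, w⟩
    · rw [deltaFun_singleton ha]
      exact zero_mem _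
    · obtain rfl : n = w.length + 1 := by simpa using hl.symm
      have hv : ∀ x ∈ b :: w, 2 ≤ x := fun x hx => h x (by simp [hx])
      have hb : 2 ≤ b := hv b (by simp)
      have hq : consMap (a - 1) (qFun (b :: w)) ∈ Ak (w.length + 1) 2 := by
        have hq' : qFun (b :: w) ∈ Ak w.length 2 := qFun_mem (by simp) hv
        obtain rfl | ha3 : a = 2 ∨ 3 ≤ a := by omega
        · rw [consMap_one hq']
          exact zero_mem _
        · exact consMap_mem (by omega) hq'
      rw [deltaFun_cons h]
      refine sub_mem (sub_mem (sub_mem (Submodule.smul_mem _ _ (br_mem_Ak (by simp) ?_))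
        (consMap_mem ha (ih (by simp) hv))) (Submodule.smul_mem _ _ hq))
        (Submodule.smul_mem _ _ (consMap_mem ha (rFun_mem (by simp) hv)))
      simp only [List.mem_cons, forall_eq_or_imp] at hv ⊢
      exact ⟨by omega, hv.2⟩

lemma anickDelta_mem {n : ℕ} {z : AnickSpace} (hz : z ∈ Ak (n + 1) 2) :
    anickDelta z ∈ Ak n 2 := by
  suffices h : Ak (n + 1) 2 ≤ (Ak n 2).comap anickDelta from h hz
  refine Ak_le fun l hne hl h => ?_
  rw [Submodule.mem_comap, anickDelta_br (anickChain_of_two_le hne h)]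
  exact deltaFun_mem hl h

/-- The differential of a chain starting with `2`. -/
lemma anickDelta_consMap_two {n : ℕ} {z : AnickSpace} (hz : z ∈ Ak n 2) :
    anickDelta (consMap 2 z) = -raiseHead z - consMap 2 (anickDelta z + rMap z) := by
  suffices h : Ak n 2 ≤ LinearMap.eqLocus (anickDelta ∘ₗ consMap 2)
      (-raiseHead - consMap 2 ∘ₗ (anickDelta + rMap)) from h hz
  refine Ak_le fun l hne hl h => ?_
  rcases l with - | ⟨b, w⟩
  · exact absurd rfl hne
  have hb : 2 ≤ b := h b (by simp)
  have h2 : ∀ x ∈ 2 :: b :: w, 2 ≤ x := by simpa using h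
  simp only [LinearMap.mem_eqLocus, LinearMap.comp_apply, LinearMap.sub_apply,
    LinearMap.neg_apply, LinearMap.add_apply]
  rw [consMap_br 2 hne, anickDelta_br (anickChain_of_two_le (by simp) h2), deltaFun_cons h2,
    raiseHead_br hb, anickDelta_br (anickChain_of_two_le hne h),
    rMap_br (anickChain_of_two_le hne h), map_add,
    show 2 - 1 = 1 from rfl, consMap_one (qFun_mem (n := w.length) (by simp) h),
    show 2 + b - 1 = b + 1 by omega,
    show ((2 : ℕ) : ℚ) * ((2 : ℕ) - 1) / ((2 : ℕ) + b - 1) = 2 / (b + 1) by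
      push_cast; congr 1 <;> ring]
  push_cast
  rw [show (2 : ℚ) - 1 = 1 by norm_num]
  module

/-- Modulo chains starting with `2`, raising the head intertwines `δ + r` and `δ`. -/
lemma lowerHead_anickDelta_raiseHead {n : ℕ} {z : AnickSpace} (hz : z ∈ Ak n 2) :
    lowerHead (anickDelta (raiseHead z)) = lowerHead (raiseHead (anickDelta z + rMap z)) := by
  suffices h : Ak n 2 ≤ LinearMap.eqLocus (lowerHead ∘ₗ anickDelta ∘ₗ raiseHead)
      (lowerHead ∘ₗ raiseHead ∘ₗ (anickDelta + rMap)) from h hz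
  refine Ak_le fun l hne hl h => ?_
  rcases l with - | ⟨a, v⟩
  · exact absurd rfl hne
  have ha : 2 ≤ a := h a (by simp)
  have h' : ∀ x ∈ (a + 1) :: v, 2 ≤ x := by
    simp only [List.mem_cons, forall_eq_or_imp] at h ⊢
    exact ⟨by omega, h.2⟩
  simp only [LinearMap.mem_eqLocus, LinearMap.comp_apply, LinearMap.add_apply]
  rw [raiseHead_br ha, map_smul, anickDelta_br (anickChain_of_two_le (by simp) h'),
    anickDelta_br (anickChain_of_two_le hne h), rMap_br (anickChain_of_two_le hne h)]
  rcases v with - | ⟨b, w⟩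
  · rw [deltaFun_singleton ha, deltaFun_singleton (by omega)]
    simp [rFun]
  have hv : ∀ x ∈ b :: w, 2 ≤ x := fun x hx => h x (by simp [hx])
  have hb : 2 ≤ b := hv b (by simp)
  have hδ : deltaFun (b :: w) ∈ Ak w.length 2 := deltaFun_mem (by simp) hv
  have hr : rFun (b :: w) ∈ Ak w.length 2 := rFun_mem (by simp) hv
  have hq : qFun (b :: w) ∈ Ak w.length 2 := qFun_mem (by simp) hv
  have hqterm : lowerHead (raiseHead ((a : ℚ) • consMap (a - 1) (qFun (b :: w)))) =
      lowerHead ((2 : ℚ) • consMap a (qFun (b :: w))) := by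
    obtain rfl | ha3 : a = 2 ∨ 3 ≤ a := by omega
    · rw [show 2 - 1 = 1 from rfl, consMap_one hq]
      simp [lowerHead_consMap_two]
    · have ha0 : (a : ℚ) ≠ 0 := by positivity
      rw [map_smul, raiseHead_consMap (by omega) hq, Nat.sub_add_cancel (by omega), smul_smul,
        Nat.cast_sub (by omega), Nat.cast_one, sub_add_cancel, mul_div_cancel₀ _ ha0]
  have ha1 : (a : ℚ) + 1 ≠ 0 := by positivity
  have hab : (a : ℚ) + b ≠ 0 := by positivity
  have hab1 : (a : ℚ) + b - 1 ≠ 0 := by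
    have : (2 : ℚ) ≤ a := by exact_mod_cast ha
    have : (2 : ℚ) ≤ b := by exact_mod_cast hb
    intro h0
    linarith
  have hhead : raiseHead (br ((a + b - 1) :: w)) = (2 / ((a : ℚ) + b)) • br ((a + b) :: w) := by
    rw [raiseHead_br (by omega), Nat.sub_add_cancel (by omega), Nat.cast_sub (by omega)]
    push_cast
    rw [sub_add_cancel]
  rw [deltaFun_cons h', deltaFun_cons h, rFun_cons, show a + 1 + b - 1 = a + b by omega,
    Nat.add_sub_cancel]
  simp only [map_add, map_sub, map_smul, map_neg, neg_smul] at hqterm ⊢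
  rw [hqterm, hhead, raiseHead_consMap ha hδ, raiseHead_consMap ha hr]
  simp only [map_smul]
  push_cast
  rw [show (a : ℚ) + 1 + b - 1 = a + b by ring, add_sub_cancel_right]
  match_scalars <;> field_simp <;> ring

/-- if `n ≥ 2`, `u ∈ A_{n,2}` and `δ_n(u) = 0`, then `u = δ_{n+1}(w)`
for some `w ∈ A_{n+1,2}`. -/
theorem cycles_in_Ak2_are_boundaries (n : ℕ) (hn : 2 ≤ n) :
    ∀ u ∈ Ak n 2, anickDelta u = 0 → ∃ w ∈ Ak (n + 1) 2, anickDelta w = u := by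
  intro u hu hδu
  obtain ⟨n, rfl⟩ := Nat.exists_eq_add_of_le' hn
  obtain ⟨y, hy, huy⟩ := exists_consMap_two (by omega) hu
  set z := lowerHead u
  have hz : z ∈ Ak (n + 2) 2 := lowerHead_mem hu
  have hz' : anickDelta z + rMap z ∈ Ak (n + 1) 2 := add_mem (anickDelta_mem hz) (rMap_mem hz)
  have hw : anickDelta (consMap 2 z) = -u + consMap 2 (y - (anickDelta z + rMap z)) := by
    rw [anickDelta_consMap_two hz, huy, map_sub]
    abel
  have hf : y - (anickDelta z + rMap z) ∈ Ak (n + 1) 2 := sub_mem hy hz'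
  suffices hzero : y - (anickDelta z + rMap z) = 0 by
    refine ⟨-consMap 2 z, neg_mem (consMap_mem le_rfl hz), ?_⟩
    rw [map_neg, hw, hzero, map_zero, add_zero, neg_neg]
  have hsq : lowerHead (anickDelta (anickDelta (consMap 2 z))) = 0 := by
    rw [anickDelta_consMap_two hz, map_sub, map_neg, anickDelta_consMap_two hz', map_sub, map_neg,
      lowerHead_anickDelta_raiseHead hz, map_sub, map_neg, lowerHead_consMap_two]
    abel
  rw [hw, map_add, map_neg, hδu, neg_zero, zero_add, anickDelta_consMap_two hf, map_sub, map_neg,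
    lowerHead_consMap_two, sub_zero, lowerHead_raiseHead hf, neg_eq_zero] at hsq
  exact hsq
end
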